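/- For every irreducible C-representation V of GL_n(F_q), the space V^N of N-fixed vectors is an irreducible C-representation of M, and the assignment V ↦ V^N induces a bijection from the set of isomorphism classes of M-regular irreducible C-representations of GL_n(F_q) onto the set of isomorphism classes of irreducible C-representations of M ≅ GL_{n₁}(F_q) × … × GL_{n_k}(F_q). Under this bijection, the M-regular irreducible V with P_V = P correspond exactly to the one-dimensional representations of M. -/

import Mathlib

open Matrix

/-!
STATEMENT 14.  `G = GL_n(F_q)`, `C` algebraically closed of characteristic `p`.  A composition
of `n` is encoded by a monotone block function `b : Fin n → ℕ`, determining the standard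
parabolic `P` (block upper triangular), its Levi `M` (block diagonal) and unipotent radical
`N`.  For every irreducible `C`-representation `V` of `G`, `V^N` is an irreducible
representation of `M`, and `V ↦ V^N` induces a bijection from iso classes of `M`-regular
irreducible representations of `G` (those with `P_V ⊆ P`) onto iso classes of irreducible
representations of `M`; under it, the `V` with `P_V = P` correspond exactly to the
one-dimensional representations of `M`.
-/

noncomputable section

/-- The full upper unitriangular subgroup, as a set. -/
def Uset (𝔽 : Type) [Field 𝔽] [Fintype 𝔽] (n : ℕ) : Set (GL (Fin n) 𝔽) :=
  {g | (∀ i j : Fin n, j < i → (↑g : Matrix (Fin n) (Fin n) 𝔽) i j = 0) ∧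
    ∀ i : Fin n, (↑g : Matrix (Fin n) (Fin n) 𝔽) i i = 1}

/-- The standard parabolic subgroup attached to `b`, as a set (block upper triangular). -/
def Pset (𝔽 : Type) [Field 𝔽] [Fintype 𝔽] {n : ℕ} (b : Fin n → ℕ) : Set (GL (Fin n) 𝔽) :=
  {g | ∀ i j : Fin n, b j < b i → (↑g : Matrix (Fin n) (Fin n) 𝔽) i j = 0}

/-- The unipotent radical of the standard parabolic attached to `b`, as a set. -/
def Nset (𝔽 : Type) [Field 𝔽] [Fintype 𝔽] {n : ℕ} (b : Fin n → ℕ) : Set (GL (Fin n) 𝔽) :=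
  {g | (∀ i j : Fin n, b j < b i → (↑g : Matrix (Fin n) (Fin n) 𝔽) i j = 0) ∧
    ∀ i j : Fin n, b i = b j →
      (↑g : Matrix (Fin n) (Fin n) 𝔽) i j = if i = j then (1 : 𝔽) else 0}

/-- The standard Levi subgroup attached to `b` (block diagonal matrices). -/
def Mgrp (𝔽 : Type) [Field 𝔽] [Fintype 𝔽] {n : ℕ} (b : Fin n → ℕ) :
    Subgroup (GL (Fin n) 𝔽) where
  carrier := {g | ∀ i j : Fin n, b i ≠ b j → (↑g : Matrix (Fin n) (Fin n) 𝔽) i j = 0}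
  mul_mem' := by
    intro g h hg hh i j hij
    show (↑(g * h) : Matrix (Fin n) (Fin n) 𝔽) i j = 0
    rw [Units.val_mul, Matrix.mul_apply]
    apply Finset.sum_eq_zero
    intro l _
    by_cases hl : b i = b l
    · rw [hh l j (fun hc => hij (hl.trans hc)), mul_zero]
    · rw [hg i l hl, zero_mul]
  one_mem' := by
    intro i j hij
    show (↑(1 : GL (Fin n) 𝔽) : Matrix (Fin n) (Fin n) 𝔽) i j = 0
    rw [Units.val_one]
    exact Matrix.one_apply_ne (fun h => hij (by rw [h]))
  inv_mem' := by
    intro g hg i j hij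
    obtain ⟨A, B, hAB, hBA⟩ := g
    show B i j = 0
    have hg' : ∀ i' j' : Fin n, b i' ≠ b j' → A i' j' = 0 := hg
    have hcomm : Matrix.diagonal (fun i' => if b i' = b i then (1 : 𝔽) else 0) * A
        = A * Matrix.diagonal (fun i' => if b i' = b i then (1 : 𝔽) else 0) := by
      ext i' j'
      rw [Matrix.diagonal_mul, Matrix.mul_diagonal]
      by_cases hij' : b i' = b j'
      · rw [hij', mul_comm]
      · rw [hg' i' j' hij', mul_zero, zero_mul]
    have key : ∀ D : Matrix (Fin n) (Fin n) 𝔽, D * A = A * D → D * B = B * D := by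
      intro D hDA
      calc D * B = (B * A) * (D * B) := by rw [hBA, one_mul]
        _ = B * ((A * D) * B) := by noncomm_ring
        _ = B * ((D * A) * B) := by rw [← hDA]
        _ = B * (D * (A * B)) := by rw [mul_assoc D A B]
        _ = B * D := by rw [hAB, mul_one]
    have hcommB := key _ hcomm
    have hentry := congr_fun (congr_fun hcommB i) j
    rw [Matrix.diagonal_mul, Matrix.mul_diagonal] at hentry
    simp only [if_neg (fun hc : b j = b i => hij hc.symm), mul_zero, if_true,
      eq_self_iff_true, one_mul] at hentry
    simpa using hentry

/-- Fixed vectors of a set of group elements. -/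
def fixedSub {C : Type} [Field C] {Γ : Type} [Monoid Γ] {V : Type} [AddCommGroup V]
    [Module C V] (ρ : Representation C Γ V) (S : Set Γ) : Submodule C V where
  carrier := {v | ∀ g ∈ S, ρ g v = v}
  add_mem' := by intro v w hv hw g hg; rw [map_add, hv g hg, hw g hg]
  zero_mem' := by intro g hg; rw [map_zero]
  smul_mem' := by intro c v hv g hg; rw [_root_.map_smul, hv g hg]

/-- Irreducibility of a representation. -/
def IsIrredRep {C : Type} [Field C] {Γ : Type} [Monoid Γ] {V : Type} [AddCommGroup V]
    [Module C V] (ρ : Representation C Γ V) : Prop :=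
  Nontrivial V ∧ ∀ S : Submodule C V, (∀ (g : Γ) (v : V), v ∈ S → ρ g v ∈ S) → S = ⊥ ∨ S = ⊤

/-- `P_V`, the stabilizer in `G` of the subspace `V^U`. -/
def PVset {𝔽 : Type} [Field 𝔽] [Fintype 𝔽] {n : ℕ} {C : Type} [Field C] {V : Type}
    [AddCommGroup V] [Module C V] (ρ : Representation C (GL (Fin n) 𝔽) V) :
    Set (GL (Fin n) 𝔽) :=
  {g | Submodule.map (ρ g : V →ₗ[C] V) (fixedSub ρ (Uset 𝔽 n)) = fixedSub ρ (Uset 𝔽 n)}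

set_option linter.unusedSectionVars false

namespace SmithGL

section

variable {𝔽 : Type} [Field 𝔽] {n : ℕ}

/-- The permutation matrix of `σ`, sending the basis vector `e_j` to `e_{σ j}`. -/
def permGL : Equiv.Perm (Fin n) →* GL (Fin n) 𝔽 where
  toFun σ :=
    { val := Matrix.of fun i j => if i = σ j then 1 else 0
      inv := Matrix.of fun i j => if i = σ⁻¹ j then 1 else 0
      val_inv := by
        ext i j
        simp [Matrix.mul_apply, Matrix.one_apply]
      inv_val := by
        ext i j
        simp [Matrix.mul_apply, Matrix.one_apply] }
  map_one' := by
    ext i j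
    simp only [Equiv.Perm.coe_one, id_eq, Matrix.of_apply, Units.val_one, Matrix.one_apply]
    congr
  map_mul' σ τ := by
    ext i j
    simp only [Matrix.of_apply, Units.val_mul, Matrix.mul_apply, mul_ite, mul_one, mul_zero,
      Finset.sum_ite_eq', Finset.mem_univ, if_true]
    rfl

lemma permGL_apply (σ : Equiv.Perm (Fin n)) (a b : Fin n) :
    (permGL σ : GL (Fin n) 𝔽).1 a b = if a = σ b then 1 else 0 := rfl

lemma permGL_mul_apply (σ : Equiv.Perm (Fin n)) (g : GL (Fin n) 𝔽) (a b : Fin n) :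
    (permGL σ * g).1 a b = g.1 (σ⁻¹ a) b := by
  rw [Units.val_mul, Matrix.mul_apply, Finset.sum_eq_single (σ⁻¹ a)]
  · simp [permGL_apply]
  · intro c _ hc
    rw [permGL_apply, if_neg, zero_mul]
    rintro rfl
    exact hc (by simp)
  · simp

lemma mul_permGL_apply (σ : Equiv.Perm (Fin n)) (g : GL (Fin n) 𝔽) (a b : Fin n) :
    (g * permGL σ).1 a b = g.1 a (σ b) := by
  rw [Units.val_mul, Matrix.mul_apply, Finset.sum_eq_single (σ b)]
  · simp [permGL_apply]
  · intro c _ hc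
    rw [permGL_apply, if_neg hc, mul_zero]
  · simp

lemma conj_permGL_apply (σ : Equiv.Perm (Fin n)) (g : GL (Fin n) 𝔽) (a b : Fin n) :
    (permGL σ * g * (permGL σ)⁻¹).1 a b = g.1 (σ⁻¹ a) (σ⁻¹ b) := by
  rw [← map_inv, mul_permGL_apply, permGL_mul_apply]

lemma inv_conj_permGL_apply (σ : Equiv.Perm (Fin n)) (g : GL (Fin n) 𝔽) (a b : Fin n) :
    ((permGL σ)⁻¹ * g * permGL σ).1 a b = g.1 (σ a) (σ b) := by
  rw [← map_inv, mul_permGL_apply, permGL_mul_apply, inv_inv]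

/-- The elementary matrix `1 + x E_{ij}`, for `i ≠ j`. -/
def elem {i j : Fin n} (h : i ≠ j) (x : 𝔽) : GL (Fin n) 𝔽 where
  val := Matrix.transvection i j x
  inv := Matrix.transvection i j (-x)
  val_inv := by rw [Matrix.transvection_mul_transvection_same _ _ h]; simp
  inv_val := by rw [Matrix.transvection_mul_transvection_same _ _ h]; simp

lemma elem_apply {i j : Fin n} (h : i ≠ j) (x : 𝔽) (a b : Fin n) :
    (elem h x).1 a b = (if a = b then 1 else 0) + if a = i ∧ b = j then x else 0 := by
  simp [elem, Matrix.transvection, Matrix.one_apply, Matrix.single_apply, eq_comm]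

lemma elem_mul_apply {i j : Fin n} (h : i ≠ j) (x : 𝔽) (g : GL (Fin n) 𝔽) (a b : Fin n) :
    (elem h x * g).1 a b = g.1 a b + if a = i then x * g.1 j b else 0 := by
  rw [Units.val_mul, Matrix.mul_apply]
  simp only [elem_apply, add_mul, Finset.sum_add_distrib, ite_mul, one_mul, zero_mul]
  congr 1
  · simp
  · by_cases ha : a = i <;> simp [ha]

lemma mul_elem_apply {i j : Fin n} (h : i ≠ j) (x : 𝔽) (g : GL (Fin n) 𝔽) (a b : Fin n) :
    (g * elem h x).1 a b = g.1 a b + if b = j then g.1 a i * x else 0 := by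
  rw [Units.val_mul, Matrix.mul_apply]
  simp only [elem_apply, mul_add, Finset.sum_add_distrib, mul_ite, mul_one, mul_zero]
  congr 1
  · simp
  · by_cases hb : b = j <;> simp [hb]

lemma elem_mul_elem {i j : Fin n} (h : i ≠ j) (x y : 𝔽) :
    elem h x * elem h y = elem h (x + y) :=
  Units.ext (Matrix.transvection_mul_transvection_same _ _ h x y)

lemma elem_zero {i j : Fin n} (h : i ≠ j) : elem h (0 : 𝔽) = 1 :=
  Units.ext (Matrix.transvection_zero i j)

/-- The diagonal matrix with entries `d`. -/
def diagGL : (Fin n → 𝔽ˣ) →* GL (Fin n) 𝔽 where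
  toFun d :=
    { val := Matrix.diagonal fun i => (d i : 𝔽)
      inv := Matrix.diagonal fun i => ((d i)⁻¹ : 𝔽ˣ)
      val_inv := by simp
      inv_val := by simp }
  map_one' := by ext i j; simp [Matrix.diagonal_apply, Matrix.one_apply]
  map_mul' d e := by
    ext i j
    simp only [Units.val_mul, Matrix.diagonal_mul_diagonal, Pi.mul_apply]

lemma diagGL_apply (d : Fin n → 𝔽ˣ) (a b : Fin n) :
    (diagGL d).1 a b = if a = b then (d a : 𝔽) else 0 := by
  simp [diagGL, Matrix.diagonal_apply]

lemma diagGL_mul_apply (d : Fin n → 𝔽ˣ) (g : GL (Fin n) 𝔽) (a b : Fin n) :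
    (diagGL d * g).1 a b = d a * g.1 a b := by
  rw [Units.val_mul]; exact Matrix.diagonal_mul _ _ _ _

lemma mul_diagGL_apply (d : Fin n → 𝔽ˣ) (g : GL (Fin n) 𝔽) (a b : Fin n) :
    (g * diagGL d).1 a b = g.1 a b * d b := by
  rw [Units.val_mul]; exact Matrix.mul_diagonal _ _ _ _

/-- The torus element with entries `-z⁻¹` at `i` and `z` at `j`. -/
def corootGL (i j : Fin n) (z : 𝔽ˣ) : GL (Fin n) 𝔽 :=
  diagGL fun k => if k = i then -z⁻¹ else if k = j then z else 1

lemma corootGL_swap {i j : Fin n} (h : i ≠ j) (z : 𝔽ˣ) :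
    corootGL j i z = corootGL i j (-z⁻¹) := by
  unfold corootGL
  congr 1
  ext k
  by_cases hi : k = i <;> by_cases hj : k = j <;> simp_all

lemma corootGL_mul (i j : Fin n) (x y : 𝔽ˣ) :
    corootGL i j (x * y) * corootGL i j 1 = corootGL i j x * corootGL i j y := by
  unfold corootGL
  rw [← map_mul, ← map_mul]
  congr 1
  ext k
  by_cases hi : k = i <;> by_cases hj : k = j <;> simp_all [mul_comm]

lemma conj_elem (σ : Equiv.Perm (Fin n)) {i j : Fin n} (h : i ≠ j) (x : 𝔽) :
    permGL σ * elem h x * (permGL σ)⁻¹ = elem (σ.injective.ne h) x := by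
  ext a b
  show (permGL σ * elem h x * (permGL σ)⁻¹).1 a b = (elem (σ.injective.ne h) x).1 a b
  rw [conj_permGL_apply, elem_apply, elem_apply]
  simp only [EmbeddingLike.apply_eq_iff_eq, Equiv.Perm.inv_eq_iff_eq]

lemma permGL_swap_mul_self (i j : Fin n) :
    (permGL (Equiv.swap i j) : GL (Fin n) 𝔽) * permGL (Equiv.swap i j) = 1 := by
  rw [← map_mul, Equiv.swap_mul_self, map_one]

lemma permGL_swap_inv (i j : Fin n) :
    (permGL (Equiv.swap i j) : GL (Fin n) 𝔽)⁻¹ = permGL (Equiv.swap i j) := by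
  rw [← map_inv, Equiv.swap_inv]

lemma swap_conj_elem {i j : Fin n} (h : i ≠ j) (x : 𝔽) :
    permGL (Equiv.swap i j) * elem h x * permGL (Equiv.swap i j) = elem h.symm x := by
  ext a b
  show (permGL (Equiv.swap i j) * elem h x * permGL (Equiv.swap i j)).1 a b = (elem h.symm x).1 a b
  nth_rw 2 [← permGL_swap_inv]
  rw [conj_elem, elem_apply, elem_apply]
  simp

/-- The rank one identity expressing a lower elementary matrix through the big cell. -/
lemma elem_eq_bigCell {i j : Fin n} (h : i ≠ j) (z : 𝔽ˣ) :
    elem h.symm (z : 𝔽) =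
      elem h ((z⁻¹ : 𝔽ˣ) : 𝔽) * corootGL i j z * permGL (Equiv.swap i j)
        * elem h ((z⁻¹ : 𝔽ˣ) : 𝔽) := by
  ext a b
  show (elem h.symm (z : 𝔽)).1 a b = (elem h ((z⁻¹ : 𝔽ˣ) : 𝔽) * corootGL i j z *
    permGL (Equiv.swap i j) * elem h ((z⁻¹ : 𝔽ˣ) : 𝔽)).1 a b
  have hz : (z : 𝔽) ≠ 0 := z.ne_zero
  simp only [mul_elem_apply, mul_permGL_apply, elem_mul_apply, corootGL, diagGL_apply, elem_apply]
  by_cases ha : a = i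
  · subst ha
    by_cases hb : b = a
    · subst hb; simp [h, h.symm, hz]
    · by_cases hb' : b = j
      · subst hb'; simp [h, h.symm, hz]
      · have : a ≠ b := Ne.symm hb
        have : j ≠ b := Ne.symm hb'
        simp [*, Equiv.swap_apply_of_ne_of_ne hb hb']
  · by_cases ha' : a = j
    · subst ha'
      by_cases hb : b = i
      · subst hb; simp [h, h.symm]
      · by_cases hb' : b = a
        · subst hb'; simp [h.symm, hz]
        · have : a ≠ b := Ne.symm hb'
          simp [*, Equiv.swap_apply_of_ne_of_ne hb hb', h.symm]
    · by_cases hb : b = i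
      · subst hb; simp [*]
      · by_cases hb' : b = j
        · subst hb'; simp [*]
        · simp [*, Equiv.swap_apply_of_ne_of_ne hb hb']

end

section

variable {𝔽 : Type} [Field 𝔽] [Fintype 𝔽] {n : ℕ}

/-- The standard parabolic subgroup attached to `b`. -/
def parabolic (𝔽 : Type) [Field 𝔽] [Fintype 𝔽] {n : ℕ} (b : Fin n → ℕ) :
    Subgroup (GL (Fin n) 𝔽) where
  carrier := Pset 𝔽 b
  one_mem' := fun i j hij => by
    show (1 : Matrix (Fin n) (Fin n) 𝔽) i j = 0
    exact Matrix.one_apply_ne (by rintro rfl; exact lt_irrefl _ hij)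
  mul_mem' := by
    intro g h hg hh
    have h1 : Matrix.BlockTriangular g.1 b := fun i j hij => hg i j hij
    have h2 : Matrix.BlockTriangular h.1 b := fun i j hij => hh i j hij
    exact fun i j hij => (h1.mul h2) hij
  inv_mem' := by
    intro g hg i j hij
    have h1 : Matrix.BlockTriangular g.1 b := fun i j hij => hg i j hij
    have : Invertible g.1 := g.invertible
    have h2 := Matrix.blockTriangular_inv_of_blockTriangular h1
    rw [Matrix.coe_units_inv]
    exact h2 hij

/-- The block diagonal part of a matrix. -/
def blockDiagPart (b : Fin n → ℕ) (A : Matrix (Fin n) (Fin n) 𝔽) :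
    Matrix (Fin n) (Fin n) 𝔽 :=
  Matrix.of fun i j => if b i = b j then A i j else 0

lemma blockDiagPart_one (b : Fin n → ℕ) :
    blockDiagPart b (1 : Matrix (Fin n) (Fin n) 𝔽) = 1 := by
  ext i j
  simp only [blockDiagPart, Matrix.of_apply, Matrix.one_apply]
  split_ifs <;> simp_all

lemma blockDiagPart_mul {b : Fin n → ℕ} {g h : GL (Fin n) 𝔽} (hg : g ∈ parabolic 𝔽 b)
    (hh : h ∈ parabolic 𝔽 b) :
    blockDiagPart b g.1 * blockDiagPart b h.1 = blockDiagPart b (g * h).1 := by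
  ext i j
  simp only [blockDiagPart, Matrix.mul_apply, Matrix.of_apply, Units.val_mul]
  split_ifs with hij
  · refine Finset.sum_congr rfl fun k _ => ?_
    rcases lt_trichotomy (b i) (b k) with hk | hk | hk
    · rw [hh k j (hij ▸ hk), if_neg hk.ne]; simp
    · rw [if_pos hk, if_pos (hk ▸ hij)]
    · rw [hg i k hk, if_neg hk.ne']; simp
  · refine Finset.sum_eq_zero fun k _ => ?_
    by_cases hk : b i = b k
    · rw [if_neg (fun h' => hij (hk.trans h')), mul_zero]
    · rw [if_neg hk, zero_mul]

/-- The projection of a parabolic subgroup onto its Levi subgroup. -/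
def leviProj (b : Fin n → ℕ) : parabolic 𝔽 b →* GL (Fin n) 𝔽 where
  toFun g :=
    { val := blockDiagPart b g.1.1
      inv := blockDiagPart b (g⁻¹).1.1
      val_inv := by
        rw [blockDiagPart_mul g.2 (g⁻¹).2, ← Subgroup.coe_mul, mul_inv_cancel]
        exact blockDiagPart_one b
      inv_val := by
        rw [blockDiagPart_mul (g⁻¹).2 g.2, ← Subgroup.coe_mul, inv_mul_cancel]
        exact blockDiagPart_one b }
  map_one' := Units.ext (blockDiagPart_one b)
  map_mul' g h := Units.ext (blockDiagPart_mul g.2 h.2).symm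

lemma leviProj_apply (b : Fin n → ℕ) (g : parabolic 𝔽 b) (i j : Fin n) :
    (leviProj b g).1 i j = if b i = b j then g.1.1 i j else 0 := rfl

lemma leviProj_mem (b : Fin n → ℕ) (g : parabolic 𝔽 b) : leviProj b g ∈ Mgrp 𝔽 b :=
  fun i j hij => by
    show (leviProj b g).1 i j = 0
    rw [leviProj_apply, if_neg hij]

lemma Mgrp_le_parabolic (b : Fin n → ℕ) : Mgrp 𝔽 b ≤ parabolic 𝔽 b :=
  fun _ hg i j hij => hg i j hij.ne'

lemma leviProj_of_mem {b : Fin n → ℕ} {g : GL (Fin n) 𝔽} (hg : g ∈ Mgrp 𝔽 b) :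
    leviProj b ⟨g, Mgrp_le_parabolic b hg⟩ = g := by
  ext i j
  show (leviProj b ⟨g, Mgrp_le_parabolic b hg⟩).1 i j = g.1 i j
  rw [leviProj_apply]
  split_ifs with h
  · rfl
  · exact (hg i j h).symm

/-- The unipotent radical of the standard parabolic attached to `b`. -/
def radical (𝔽 : Type) [Field 𝔽] [Fintype 𝔽] {n : ℕ} (b : Fin n → ℕ) :
    Subgroup (GL (Fin n) 𝔽) :=
  (leviProj (𝔽 := 𝔽) b).ker.map (parabolic 𝔽 b).subtype

lemma mem_radical {b : Fin n → ℕ} {g : GL (Fin n) 𝔽} :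
    g ∈ radical 𝔽 b ↔ ∃ h : g ∈ parabolic 𝔽 b, leviProj b ⟨g, h⟩ = 1 := by
  simp only [radical, Subgroup.mem_map, MonoidHom.mem_ker, Subgroup.subtype_apply, Subtype.exists]
  constructor
  · rintro ⟨a, ha, h1, rfl⟩
    exact ⟨ha, h1⟩
  · rintro ⟨ha, h1⟩
    exact ⟨g, ha, h1, rfl⟩

lemma radical_eq_Nset (b : Fin n → ℕ) : (radical 𝔽 b : Set (GL (Fin n) 𝔽)) = Nset 𝔽 b := by
  ext g
  rw [SetLike.mem_coe, mem_radical]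
  constructor
  · rintro ⟨h, h1⟩
    refine ⟨h, fun i j hij => ?_⟩
    have := congrArg (fun x : GL (Fin n) 𝔽 => x.1 i j) h1
    simp only [leviProj_apply, if_pos hij] at this
    rw [this, Units.val_one, Matrix.one_apply]
  · rintro ⟨h, h1⟩
    refine ⟨h, ?_⟩
    ext i j
    show (leviProj b ⟨g, h⟩).1 i j = (1 : Matrix (Fin n) (Fin n) 𝔽) i j
    rw [leviProj_apply, Matrix.one_apply]
    split_ifs with h2 h3 h3
    · rw [h1 i j h2, if_pos h3]
    · rw [h1 i j h2, if_neg h3]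
    · subst h3; exact absurd rfl h2
    · rfl

lemma conj_mem_radical {b : Fin n → ℕ} {g x : GL (Fin n) 𝔽} (hg : g ∈ parabolic 𝔽 b)
    (hx : x ∈ radical 𝔽 b) : g⁻¹ * x * g ∈ radical 𝔽 b := by
  obtain ⟨hx, h1⟩ := mem_radical.1 hx
  refine mem_radical.2 ⟨mul_mem (mul_mem (inv_mem hg) hx) hg, ?_⟩
  have : (⟨g⁻¹ * x * g, mul_mem (mul_mem (inv_mem hg) hx) hg⟩ : parabolic 𝔽 b)
      = ⟨g, hg⟩⁻¹ * ⟨x, hx⟩ * ⟨g, hg⟩ := rfl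
  rw [this, map_mul, map_mul, h1, mul_one, ← map_mul, inv_mul_cancel, map_one]

lemma exists_levi_mul_radical {b : Fin n → ℕ} {g : GL (Fin n) 𝔽} (hg : g ∈ parabolic 𝔽 b) :
    ∃ x ∈ radical 𝔽 b, g = leviProj b ⟨g, hg⟩ * x := by
  set m := leviProj b ⟨g, hg⟩ with hm
  have hmM : m ∈ Mgrp 𝔽 b := leviProj_mem b _
  have hmP := Mgrp_le_parabolic b hmM
  refine ⟨m⁻¹ * g, mem_radical.2 ⟨mul_mem (inv_mem hmP) hg, ?_⟩, by group⟩
  have : (⟨m⁻¹ * g, mul_mem (inv_mem hmP) hg⟩ : parabolic 𝔽 b) = ⟨m, hmP⟩⁻¹ * ⟨g, hg⟩ := rfl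
  rw [this, map_mul, map_inv, leviProj_of_mem hmM, ← hm, inv_mul_cancel]

/-- The upper unitriangular subgroup. -/
abbrev unip (𝔽 : Type) [Field 𝔽] [Fintype 𝔽] (n : ℕ) : Subgroup (GL (Fin n) 𝔽) :=
  radical 𝔽 (Fin.val : Fin n → ℕ)

lemma Nset_val : Nset 𝔽 (Fin.val : Fin n → ℕ) = Uset 𝔽 n := by
  ext g
  constructor
  · rintro ⟨h1, h2⟩
    exact ⟨fun i j hij => h1 i j hij, fun i => by rw [h2 i i rfl, if_pos rfl]⟩
  · rintro ⟨h1, h2⟩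
    refine ⟨fun i j hij => h1 i j hij, fun i j hij => ?_⟩
    obtain rfl := Fin.ext hij
    rw [h2, if_pos rfl]

lemma unip_eq_Uset : (unip 𝔽 n : Set (GL (Fin n) 𝔽)) = Uset 𝔽 n := by
  rw [unip, radical_eq_Nset, Nset_val]

lemma mem_unip {g : GL (Fin n) 𝔽} :
    g ∈ unip 𝔽 n ↔ (∀ i j : Fin n, j < i → g.1 i j = 0) ∧ ∀ i : Fin n, g.1 i i = 1 := by
  rw [← SetLike.mem_coe, unip_eq_Uset]; rfl

lemma mem_radical_iff {b : Fin n → ℕ} {g : GL (Fin n) 𝔽} :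
    g ∈ radical 𝔽 b ↔ (∀ i j : Fin n, b j < b i → g.1 i j = 0) ∧
      ∀ i j : Fin n, b i = b j → g.1 i j = if i = j then (1 : 𝔽) else 0 := by
  rw [← SetLike.mem_coe, radical_eq_Nset]; rfl

lemma unip_le_parabolic {b : Fin n → ℕ} (hb : Monotone b) : unip 𝔽 n ≤ parabolic 𝔽 b :=
  fun _ hg i j hij => (mem_unip.1 hg).1 i j (hb.reflect_lt hij)

lemma radical_le_unip {b : Fin n → ℕ} (hb : Monotone b) : radical 𝔽 b ≤ unip 𝔽 n := by
  intro g hg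
  rw [mem_radical_iff] at hg
  refine mem_unip.2 ⟨fun i j hij => ?_, fun i => by rw [hg.2 i i rfl, if_pos rfl]⟩
  rcases (hb hij.le).lt_or_eq with h | h
  · exact hg.1 i j h
  · rw [hg.2 i j h.symm, if_neg hij.ne']

lemma leviProj_mem_unip {b : Fin n → ℕ} {g : GL (Fin n) 𝔽} (hg : g ∈ parabolic 𝔽 b)
    (hu : g ∈ unip 𝔽 n) : leviProj b ⟨g, hg⟩ ∈ unip 𝔽 n := by
  rw [mem_unip] at hu ⊢
  refine ⟨fun i j hij => ?_, fun i => ?_⟩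
  · rw [leviProj_apply]
    simp [hu.1 i j hij]
  · rw [leviProj_apply, if_pos rfl]
    exact hu.2 i

lemma diagGL_mem_Mgrp (b : Fin n → ℕ) (d : Fin n → 𝔽ˣ) : diagGL d ∈ Mgrp 𝔽 b := by
  intro i j hij
  show (diagGL d).1 i j = 0
  rw [diagGL_apply, if_neg (by rintro rfl; exact hij rfl)]

lemma exists_eq_diagGL {g : GL (Fin n) 𝔽} (hg : g ∈ Mgrp 𝔽 (Fin.val : Fin n → ℕ)) :
    ∃ d, g = diagGL d := by
  have h0 : ∀ i j, i ≠ j → g.1 i j = 0 := fun i j hij => hg i j (Fin.val_injective.ne hij)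
  have h1 : ∀ i, g.1 i i * (g⁻¹).1 i i = 1 := by
    intro i
    have := congrArg (fun x : GL (Fin n) 𝔽 => x.1 i i) (mul_inv_cancel g)
    simp only [Units.val_mul, Matrix.mul_apply, Units.val_one, Matrix.one_apply_eq] at this
    rwa [Finset.sum_eq_single i (fun k _ hk => by rw [h0 i k hk.symm, zero_mul])
      (by simp)] at this
  refine ⟨fun i => Units.mk0 (g.1 i i) (left_ne_zero_of_mul (by rw [h1]; exact one_ne_zero)), ?_⟩
  ext i j
  show g.1 i j = (diagGL _).1 i j
  rw [diagGL_apply]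
  split_ifs with h
  · subst h; rfl
  · exact h0 i j h

lemma elem_mem_unip {i j : Fin n} (h : i < j) (x : 𝔽) : elem h.ne x ∈ unip 𝔽 n := by
  refine mem_unip.2 ⟨fun a c hac => ?_, fun a => ?_⟩
  · rw [elem_apply, if_neg hac.ne', if_neg, add_zero]
    rintro ⟨rfl, rfl⟩
    exact lt_asymm h hac
  · rw [elem_apply, if_pos rfl, if_neg, add_zero]
    rintro ⟨rfl, rfl⟩
    exact lt_irrefl _ h

lemma elem_mem_Mgrp {b : Fin n → ℕ} {i j : Fin n} (h : i ≠ j) (hb : b i = b j) (x : 𝔽) :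
    elem h x ∈ Mgrp 𝔽 b := by
  intro a c hac
  show (elem h x).1 a c = 0
  rw [elem_apply, if_neg (by rintro rfl; exact hac rfl), if_neg, add_zero]
  rintro ⟨rfl, rfl⟩
  exact hac hb

lemma swap_mem_Mgrp {b : Fin n → ℕ} {i j : Fin n} (hb : b i = b j) :
    permGL (Equiv.swap i j) ∈ Mgrp 𝔽 b := by
  intro a c hac
  show (permGL (Equiv.swap i j)).1 a c = 0
  rw [permGL_apply, if_neg]
  rintro rfl
  apply hac
  by_cases hi : c = i
  · subst hi; rw [Equiv.swap_apply_left, hb]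
  · by_cases hj : c = j
    · subst hj; rw [Equiv.swap_apply_right, hb]
    · rw [Equiv.swap_apply_of_ne_of_ne hi hj]

/-- Transposition of invertible matrices. -/
def transp (g : GL (Fin n) 𝔽) : GL (Fin n) 𝔽 where
  val := g.1ᵀ
  inv := (g⁻¹).1ᵀ
  val_inv := by rw [← Matrix.transpose_mul, ← Units.val_mul, inv_mul_cancel]; simp
  inv_val := by rw [← Matrix.transpose_mul, ← Units.val_mul, mul_inv_cancel]; simp

lemma transp_apply (g : GL (Fin n) 𝔽) (i j : Fin n) : (transp g).1 i j = g.1 j i := rfl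

lemma transp_transp (g : GL (Fin n) 𝔽) : transp (transp g) = g := rfl

lemma transp_mul (g h : GL (Fin n) 𝔽) : transp (g * h) = transp h * transp g :=
  Units.ext (Matrix.transpose_mul _ _)

lemma transp_one : transp (1 : GL (Fin n) 𝔽) = 1 := Units.ext Matrix.transpose_one

lemma transp_inv (g : GL (Fin n) 𝔽) : transp g⁻¹ = (transp g)⁻¹ := by
  rw [eq_inv_iff_mul_eq_one, ← transp_mul, mul_inv_cancel, transp_one]

/-- The lower unitriangular subgroup. -/
def lowerUnip (𝔽 : Type) [Field 𝔽] [Fintype 𝔽] (n : ℕ) : Subgroup (GL (Fin n) 𝔽) where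
  carrier := {g | transp g ∈ unip 𝔽 n}
  one_mem' := by
    show transp 1 ∈ unip 𝔽 n
    rw [transp_one]; exact one_mem _
  mul_mem' := by
    intro g h hg hh
    show transp (g * h) ∈ unip 𝔽 n
    rw [transp_mul]; exact mul_mem hh hg
  inv_mem' := by
    intro g hg
    show transp g⁻¹ ∈ unip 𝔽 n
    rw [transp_inv]; exact inv_mem hg

lemma mem_lowerUnip {g : GL (Fin n) 𝔽} : g ∈ lowerUnip 𝔽 n ↔ transp g ∈ unip 𝔽 n := Iff.rfl

lemma mem_lowerUnip_iff {g : GL (Fin n) 𝔽} :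
    g ∈ lowerUnip 𝔽 n ↔ (∀ i j : Fin n, i < j → g.1 i j = 0) ∧ ∀ i : Fin n, g.1 i i = 1 := by
  rw [mem_lowerUnip, mem_unip]
  exact and_congr ⟨fun h i j hij => h j i hij, fun h i j hij => h j i hij⟩ Iff.rfl

lemma elem_mem_lowerUnip {i j : Fin n} (h : j < i) (x : 𝔽) :
    elem h.ne' x ∈ lowerUnip 𝔽 n := by
  refine mem_lowerUnip_iff.2 ⟨fun a c hac => ?_, fun a => ?_⟩
  · rw [elem_apply, if_neg hac.ne, if_neg, add_zero]
    rintro ⟨rfl, rfl⟩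
    exact lt_asymm h hac
  · rw [elem_apply, if_pos rfl, if_neg, add_zero]
    rintro ⟨rfl, rfl⟩
    exact lt_irrefl _ h

lemma transp_swap (i j : Fin n) :
    transp (permGL (Equiv.swap i j) : GL (Fin n) 𝔽) = permGL (Equiv.swap i j) := by
  ext a c
  show (transp (permGL (Equiv.swap i j))).1 a c = (permGL (Equiv.swap i j)).1 a c
  rw [transp_apply, permGL_apply, permGL_apply]
  congr 1
  rw [eq_iff_iff, ← Equiv.swap_inv i j, Equiv.Perm.eq_inv_iff_eq, Equiv.swap_inv, eq_comm]

lemma conj_diag_apply (d : Fin n → 𝔽ˣ) (g : GL (Fin n) 𝔽) (a c : Fin n) :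
    ((diagGL d)⁻¹ * g * diagGL d).1 a c = (d a : 𝔽)⁻¹ * g.1 a c * d c := by
  rw [mul_diagGL_apply, ← map_inv, diagGL_mul_apply]
  simp

lemma conj_diag_mem_unip (d : Fin n → 𝔽ˣ) {g : GL (Fin n) 𝔽} (hg : g ∈ unip 𝔽 n) :
    (diagGL d)⁻¹ * g * diagGL d ∈ unip 𝔽 n :=
  conj_mem_radical (Mgrp_le_parabolic _ (diagGL_mem_Mgrp _ d)) hg

lemma conj_diag_mem_lowerUnip (d : Fin n → 𝔽ˣ) {g : GL (Fin n) 𝔽} (hg : g ∈ lowerUnip 𝔽 n) :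
    (diagGL d)⁻¹ * g * diagGL d ∈ lowerUnip 𝔽 n := by
  rw [mem_lowerUnip_iff] at hg ⊢
  refine ⟨fun i j hij => ?_, fun i => ?_⟩
  · rw [conj_diag_apply, hg.1 i j hij]; simp
  · rw [conj_diag_apply, hg.2 i]; simp

lemma swap_adj_lt {i j a c : Fin n} (hij : (i : ℕ) + 1 = j) (hac : a < c)
    (hne : ¬ (a = i ∧ c = j)) : Equiv.swap i j a < Equiv.swap i j c := by
  rw [Fin.lt_def] at *
  by_cases h1 : a = i
  · subst h1
    have h2 : c ≠ j := fun h => hne ⟨rfl, h⟩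
    have h3 : c ≠ a := by rintro rfl; exact lt_irrefl _ hac
    have h2' : (c : ℕ) ≠ j := fun h => h2 (Fin.ext h)
    rw [Equiv.swap_apply_left, Equiv.swap_apply_of_ne_of_ne h3 h2]
    omega
  · by_cases h2 : a = j
    · subst h2
      have h3 : c ≠ a := by rintro rfl; exact lt_irrefl _ hac
      have h4 : c ≠ i := by rintro rfl; omega
      rw [Equiv.swap_apply_right, Equiv.swap_apply_of_ne_of_ne h4 h3]
      omega
    · rw [Equiv.swap_apply_of_ne_of_ne h1 h2]
      have h1' : (a : ℕ) ≠ i := fun h => h1 (Fin.ext h)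
      by_cases h3 : c = i
      · subst h3; rw [Equiv.swap_apply_left]; omega
      · by_cases h4 : c = j
        · subst h4; rw [Equiv.swap_apply_right]; omega
        · rw [Equiv.swap_apply_of_ne_of_ne h3 h4]; exact hac

lemma swap_conj_apply (i j : Fin n) (g : GL (Fin n) 𝔽) (a c : Fin n) :
    (permGL (Equiv.swap i j) * g * permGL (Equiv.swap i j)).1 a c
      = g.1 (Equiv.swap i j a) (Equiv.swap i j c) := by
  rw [mul_permGL_apply, permGL_mul_apply, Equiv.swap_inv]

lemma swap_conj_mem_unip {i j : Fin n} (hij : (i : ℕ) + 1 = j) {g : GL (Fin n) 𝔽}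
    (hg : g ∈ unip 𝔽 n) (h0 : g.1 i j = 0) :
    permGL (Equiv.swap i j) * g * permGL (Equiv.swap i j) ∈ unip 𝔽 n := by
  rw [mem_unip] at hg ⊢
  refine ⟨fun a c hac => ?_, fun a => ?_⟩
  · rw [swap_conj_apply]
    by_cases hne : c = i ∧ a = j
    · rw [hne.1, hne.2, Equiv.swap_apply_left, Equiv.swap_apply_right, h0]
    · exact hg.1 _ _ (swap_adj_lt hij hac hne)
  · rw [swap_conj_apply, hg.2]

lemma swap_conj_mem_lowerUnip {i j : Fin n} (hij : (i : ℕ) + 1 = j) {g : GL (Fin n) 𝔽}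
    (hg : g ∈ lowerUnip 𝔽 n) (h0 : g.1 j i = 0) :
    permGL (Equiv.swap i j) * g * permGL (Equiv.swap i j) ∈ lowerUnip 𝔽 n := by
  rw [mem_lowerUnip] at hg ⊢
  have := swap_conj_mem_unip hij hg h0
  rwa [transp_mul, transp_mul, transp_swap, ← mul_assoc]

end

section

variable {𝔽 : Type} [Field 𝔽] [Fintype 𝔽] {n : ℕ}

lemma permGL_mem_of_swap (Q : Submonoid (GL (Fin n) 𝔽))
    (hs : ∀ i j : Fin n, (i : ℕ) + 1 = j → permGL (Equiv.swap i j) ∈ Q)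
    (σ : Equiv.Perm (Fin n)) : permGL σ ∈ Q := by
  cases n with
  | zero =>
    rw [Subsingleton.elim σ 1, map_one]
    exact one_mem _
  | succ m =>
    have h : σ ∈ Submonoid.closure
        (Set.range fun i : Fin m => Equiv.swap i.castSucc i.succ) := by
      rw [Equiv.Perm.mclosure_swap_castSucc_succ]; trivial
    have h2 : Submonoid.closure (Set.range fun i : Fin m => Equiv.swap i.castSucc i.succ)
        ≤ Q.comap (permGL (𝔽 := 𝔽) (n := m + 1)) := by
      rw [Submonoid.closure_le]
      rintro _ ⟨i, rfl⟩
      exact hs _ _ (by simp)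
    exact h2 h

lemma exists_perm_pair {i j a c : Fin n} (hij : i ≠ j) (hac : a ≠ c) :
    ∃ σ : Equiv.Perm (Fin n), σ i = a ∧ σ j = c := by
  refine ⟨Equiv.swap (Equiv.swap i a j) c * Equiv.swap i a, ?_, ?_⟩
  · rw [Equiv.Perm.mul_apply, Equiv.swap_apply_left, Equiv.swap_apply_of_ne_of_ne _ hac]
    intro h
    have : Equiv.swap i a i = Equiv.swap i a j := by rw [← h, Equiv.swap_apply_left]
    exact hij ((Equiv.swap i a).injective this)
  · rw [Equiv.Perm.mul_apply, Equiv.swap_apply_left]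

/-- Adjacent transpositions, diagonal matrices and simple root elements generate `GL_n`. -/
lemma mem_of_generators (Q : Submonoid (GL (Fin n) 𝔽))
    (hs : ∀ i j : Fin n, (i : ℕ) + 1 = j → permGL (Equiv.swap i j) ∈ Q)
    (hd : ∀ d, diagGL d ∈ Q)
    (hu : ∀ (i j : Fin n) (h : i < j), (i : ℕ) + 1 = j → ∀ x, elem h.ne x ∈ Q)
    (g : GL (Fin n) 𝔽) : g ∈ Q := by
  classical
  have hp := permGL_mem_of_swap Q hs
  have hel : ∀ (a c : Fin n) (h : a ≠ c) (x : 𝔽), elem h x ∈ Q := by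
    intro a c h x
    have hn : 1 < n := by
      rcases Nat.lt_or_ge 1 n with h1 | h1
      · exact h1
      · exact absurd (Fin.ext (by omega)) h
    have h01 : (⟨0, by omega⟩ : Fin n) < ⟨1, hn⟩ := by simp
    obtain ⟨σ, rfl, rfl⟩ := exists_perm_pair h01.ne h
    have := Q.mul_mem (Q.mul_mem (hp σ) (hu _ _ h01 rfl x)) (hp σ⁻¹)
    rwa [map_inv, conj_elem] at this
  have key : ∀ A : Matrix (Fin n) (Fin n) 𝔽, A.det ≠ 0 → ∃ g ∈ Q, g.1 = A := by
    intro A hA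
    refine Matrix.diagonal_transvection_induction_of_det_ne_zero
      (fun A => ∃ g ∈ Q, g.1 = A) A hA ?_ ?_ ?_
    · intro D hD
      rw [Matrix.det_diagonal, Finset.prod_ne_zero_iff] at hD
      exact ⟨diagGL fun i => Units.mk0 (D i) (hD i (Finset.mem_univ i)), hd _, rfl⟩
    · intro t
      exact ⟨elem t.hij t.c, hel _ _ _ _, rfl⟩
    · rintro A B - - ⟨g, hg, rfl⟩ ⟨h, hh, rfl⟩
      exact ⟨g * h, mul_mem hg hh, rfl⟩
  obtain ⟨g', hg', h⟩ := key g.1 ((Matrix.isUnit_iff_isUnit_det _).1 g.isUnit).ne_zero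
  rwa [← Units.ext h]

/-- The group `U ∩ w U⁻ w⁻¹`, where `U⁻` is the lower unitriangular group. -/
def invUnip (𝔽 : Type) [Field 𝔽] [Fintype 𝔽] {n : ℕ} (w : Equiv.Perm (Fin n)) :
    Set (GL (Fin n) 𝔽) :=
  {u | u ∈ unip 𝔽 n ∧ (permGL w)⁻¹ * u * permGL w ∈ lowerUnip 𝔽 n}

lemma mem_invUnip {w : Equiv.Perm (Fin n)} {u : GL (Fin n) 𝔽} :
    u ∈ invUnip 𝔽 w ↔
      u ∈ unip 𝔽 n ∧ (permGL w)⁻¹ * u * permGL w ∈ lowerUnip 𝔽 n := Iff.rfl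

lemma invUnip_apply_eq_zero {w : Equiv.Perm (Fin n)} {u : GL (Fin n) 𝔽}
    (hu : u ∈ invUnip 𝔽 w) {i j : Fin n} (hw : w⁻¹ i < w⁻¹ j) : u.1 i j = 0 := by
  have := (mem_lowerUnip_iff.1 hu.2).1 _ _ hw
  simpa [inv_conj_permGL_apply] using this

lemma invUnip_conj_swap (i j : Fin n) (w : Equiv.Perm (Fin n)) (u : GL (Fin n) 𝔽) :
    (permGL (Equiv.swap i j * w))⁻¹ *
      (permGL (Equiv.swap i j) * u * permGL (Equiv.swap i j)) * permGL (Equiv.swap i j * w) =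
    (permGL w)⁻¹ * u * permGL w := by
  rw [map_mul, _root_.mul_inv_rev, permGL_swap_inv]
  have h := permGL_swap_mul_self (𝔽 := 𝔽) i j
  calc _ = (permGL w)⁻¹ * (permGL (Equiv.swap i j) * permGL (Equiv.swap i j)) * u *
        (permGL (Equiv.swap i j) * permGL (Equiv.swap i j)) * permGL w := by
        simp only [mul_assoc]
    _ = _ := by rw [h, mul_one, mul_one]

lemma conj_elem_swap_mem_lowerUnip {i j : Fin n} (h : i ≠ j) {w : Equiv.Perm (Fin n)}
    (hw : w⁻¹ i < w⁻¹ j) (x : 𝔽) :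
    (permGL (Equiv.swap i j * w))⁻¹ * elem h x * permGL (Equiv.swap i j * w)
      ∈ lowerUnip 𝔽 n := by
  have := conj_elem (𝔽 := 𝔽) (Equiv.swap i j * w)⁻¹ h x
  rw [map_inv, inv_inv] at this
  rw [this]
  refine elem_mem_lowerUnip ?_ x
  simpa [_root_.mul_inv_rev] using hw

lemma elem_mul_conj_mem_invUnip {i j : Fin n} (hij : (i : ℕ) + 1 = j) (h : i < j)
    {w : Equiv.Perm (Fin n)} (hw : w⁻¹ i < w⁻¹ j) (x : 𝔽) {u : GL (Fin n) 𝔽}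
    (hu : u ∈ invUnip 𝔽 w) :
    elem h.ne x * (permGL (Equiv.swap i j) * u * permGL (Equiv.swap i j))
      ∈ invUnip 𝔽 (Equiv.swap i j * w) := by
  refine mem_invUnip.2 ⟨mul_mem (elem_mem_unip h x)
    (swap_conj_mem_unip hij hu.1 (invUnip_apply_eq_zero hu hw)), ?_⟩
  have : ∀ P a b : GL (Fin n) 𝔽, P⁻¹ * (a * b) * P = (P⁻¹ * a * P) * (P⁻¹ * b * P) := by
    intros; group
  rw [this, invUnip_conj_swap]
  exact mul_mem (conj_elem_swap_mem_lowerUnip h.ne hw x) hu.2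

lemma elem_mul_conj_apply {i j : Fin n} (h : i < j) (x : 𝔽)
    {u : GL (Fin n) 𝔽} (hu : u ∈ unip 𝔽 n) :
    (elem h.ne x * (permGL (Equiv.swap i j) * u * permGL (Equiv.swap i j))).1 i j = x := by
  rw [elem_mul_apply, if_pos rfl, swap_conj_apply, swap_conj_apply]
  simp [(mem_unip.1 hu).2, (mem_unip.1 hu).1 j i h]

lemma exists_of_mem_invUnip_swap {i j : Fin n} (hij : (i : ℕ) + 1 = j) (h : i < j)
    {w : Equiv.Perm (Fin n)} (hw : w⁻¹ i < w⁻¹ j) {g : GL (Fin n) 𝔽}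
    (hg : g ∈ invUnip 𝔽 (Equiv.swap i j * w)) :
    ∃ u ∈ invUnip 𝔽 w, g = elem h.ne (g.1 i j) *
      (permGL (Equiv.swap i j) * u * permGL (Equiv.swap i j)) := by
  set s : GL (Fin n) 𝔽 := permGL (Equiv.swap i j) with hs
  have hss : s * s = 1 := permGL_swap_mul_self i j
  have hgu := mem_unip.1 hg.1
  have h1 : elem h.ne (-g.1 i j) * g ∈ unip 𝔽 n := mul_mem (elem_mem_unip h _) hg.1
  have h2 : (elem h.ne (-g.1 i j) * g).1 i j = 0 := by
    rw [elem_mul_apply, if_pos rfl, hgu.2 j]; ring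
  have h3 : s * (s * (elem h.ne (-g.1 i j) * g) * s) * s = elem h.ne (-g.1 i j) * g := by
    calc _ = (s * s) * (elem h.ne (-g.1 i j) * g) * (s * s) := by simp only [mul_assoc]
      _ = _ := by rw [hss, mul_one, one_mul]
  refine ⟨s * (elem h.ne (-g.1 i j) * g) * s, ⟨swap_conj_mem_unip hij h1 h2, ?_⟩, ?_⟩
  · rw [← invUnip_conj_swap i j, ← hs, h3]
    have : ∀ P a b : GL (Fin n) 𝔽, P⁻¹ * (a * b) * P = (P⁻¹ * a * P) * (P⁻¹ * b * P) := by
      intros; group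
    rw [this]
    exact mul_mem (conj_elem_swap_mem_lowerUnip h.ne hw _) hg.2
  · rw [h3, ← mul_assoc, elem_mul_elem, add_neg_cancel, elem_zero, one_mul]

/-- The elements of `invUnip` as a finite set. -/
def invUnipFin (𝔽 : Type) [Field 𝔽] [Fintype 𝔽] {n : ℕ} (w : Equiv.Perm (Fin n)) :
    Finset (GL (Fin n) 𝔽) :=
  (Set.toFinite (invUnip 𝔽 w)).toFinset

lemma mem_invUnipFin {w : Equiv.Perm (Fin n)} {u : GL (Fin n) 𝔽} :
    u ∈ invUnipFin 𝔽 w ↔ u ∈ invUnip 𝔽 w := by simp [invUnipFin]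

/-- Summation over `invUnip` when the length of `w` increases by one. -/
lemma sum_invUnip_swap {A : Type} [AddCommMonoid A] {i j : Fin n} (hij : (i : ℕ) + 1 = j)
    (h : i < j) {w : Equiv.Perm (Fin n)} (hw : w⁻¹ i < w⁻¹ j) (f : GL (Fin n) 𝔽 → A) :
    ∑ g ∈ invUnipFin 𝔽 (Equiv.swap i j * w), f g =
      ∑ x : 𝔽, ∑ u ∈ invUnipFin 𝔽 w,
        f (elem h.ne x * (permGL (Equiv.swap i j) * u * permGL (Equiv.swap i j))) := by
  rw [← Finset.sum_product']
  symm
  refine Finset.sum_bij (fun p _ => elem h.ne p.1 *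
    (permGL (Equiv.swap i j) * p.2 * permGL (Equiv.swap i j))) ?_ ?_ ?_ ?_
  · rintro ⟨x, u⟩ hp
    rw [Finset.mem_product] at hp
    exact mem_invUnipFin.2 (elem_mul_conj_mem_invUnip hij h hw x (mem_invUnipFin.1 hp.2))
  · rintro ⟨x, u⟩ hp ⟨y, v⟩ hq heq
    rw [Finset.mem_product] at hp hq
    have hu := mem_invUnipFin.1 hp.2
    have hv := mem_invUnipFin.1 hq.2
    have hxy : x = y := by
      rw [← elem_mul_conj_apply h x hu.1, ← elem_mul_conj_apply h y hv.1]
      exact congrArg (fun g : GL (Fin n) 𝔽 => g.1 i j) heq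
    subst hxy
    simpa using heq
  · intro g hg
    obtain ⟨u, hu, hgu⟩ := exists_of_mem_invUnip_swap hij h hw (mem_invUnipFin.1 hg)
    exact ⟨(g.1 i j, u), Finset.mem_product.2 ⟨Finset.mem_univ _, mem_invUnipFin.2 hu⟩, hgu.symm⟩
  · intros; rfl

lemma card_invUnip_swap_lt (𝔽 : Type) [Field 𝔽] [Fintype 𝔽] {i j : Fin n} (hij : (i : ℕ) + 1 = j)
    {w : Equiv.Perm (Fin n)} (hw : w⁻¹ i < w⁻¹ j) :
    (invUnipFin 𝔽 w).card < (invUnipFin 𝔽 (Equiv.swap i j * w)).card := by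
  have h : i < j := by rw [Fin.lt_def]; omega
  have h1 := sum_invUnip_swap (𝔽 := 𝔽) hij h hw (fun _ => 1)
  simp only [Finset.sum_const, smul_eq_mul, mul_one] at h1
  rw [h1, Finset.card_univ]
  have h2 : 1 < Fintype.card 𝔽 := Fintype.one_lt_card
  have h3 : 0 < (invUnipFin 𝔽 w).card :=
    Finset.card_pos.2 ⟨1, mem_invUnipFin.2 ⟨one_mem _, by simp [one_mem]⟩⟩
  nlinarith

lemma eq_one_of_no_descent {w : Equiv.Perm (Fin n)}
    (h : ∀ i j : Fin n, (i : ℕ) + 1 = j → w⁻¹ i < w⁻¹ j) : w = 1 := by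
  have hmono : StrictMono (w⁻¹ : Equiv.Perm (Fin n)) := by
    cases n with
    | zero => exact fun a => a.elim0
    | succ m => exact Fin.strictMono_iff_lt_succ.2 fun i => h _ _ (by simp)
  have : w⁻¹ = 1 := by
    ext a
    have := congrArg (fun e : Fin n ≃o Fin n => e a)
      (Subsingleton.elim (hmono.orderIsoOfSurjective _ (w⁻¹ : Equiv.Perm (Fin n)).surjective)
        (OrderIso.refl _))
    exact congrArg Fin.val this
  exact inv_eq_one.1 this

/-- Induction on permutations along length-increasing left multiplications by adjacent
transpositions. -/
lemma perm_ascent_induction {motive : Equiv.Perm (Fin n) → Prop} (one : motive 1)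
    (step : ∀ (w : Equiv.Perm (Fin n)) (i j : Fin n), (i : ℕ) + 1 = j → w⁻¹ i < w⁻¹ j →
      motive w → motive (Equiv.swap i j * w)) (w : Equiv.Perm (Fin n)) : motive w := by
  have : Fact (Nat.Prime 2) := ⟨Nat.prime_two⟩
  induction hk : (invUnipFin (ZMod 2) w).card using Nat.strong_induction_on generalizing w with
  | _ k ih =>
    by_cases hd : ∀ i j : Fin n, (i : ℕ) + 1 = j → w⁻¹ i < w⁻¹ j
    · rw [eq_one_of_no_descent hd]; exact one
    · push Not at hd
      obtain ⟨i, j, hij, hw⟩ := hd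
      have hne : i ≠ j := by rintro rfl; omega
      have hw' : (Equiv.swap i j * w)⁻¹ i < (Equiv.swap i j * w)⁻¹ j := by
        rw [_root_.mul_inv_rev, Equiv.swap_inv, Equiv.Perm.mul_apply, Equiv.Perm.mul_apply,
          Equiv.swap_apply_left, Equiv.swap_apply_right]
        exact lt_of_le_of_ne hw ((w⁻¹ : Equiv.Perm (Fin n)).injective.ne hne.symm)
      have hss : Equiv.swap i j * (Equiv.swap i j * w) = w := by
        rw [← mul_assoc, Equiv.swap_mul_self, one_mul]
      have hlt := card_invUnip_swap_lt (ZMod 2) hij hw'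
      rw [hss] at hlt
      have := step _ i j hij hw' (ih _ (hk ▸ hlt) _ rfl)
      rwa [hss] at this

end

section

variable {𝔽 : Type} [Field 𝔽] [Fintype 𝔽] {n : ℕ} {C : Type} [Field C]
  {V : Type} [AddCommGroup V] [Module C V]

instance unitsFintype : Fintype 𝔽ˣ := Fintype.ofFinite _

lemma mem_fixedSub {Γ : Type} [Monoid Γ] {ρ : Representation C Γ V} {S : Set Γ} {v : V} :
    v ∈ fixedSub ρ S ↔ ∀ g ∈ S, ρ g v = v := Iff.rfl

lemma mem_fixed_unip {ρ : Representation C (GL (Fin n) 𝔽) V} {v : V} :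
    v ∈ fixedSub ρ (Uset 𝔽 n) ↔ ∀ g ∈ unip 𝔽 n, ρ g v = v := by
  rw [mem_fixedSub, ← unip_eq_Uset]; rfl

lemma mem_fixed_radical {b : Fin n → ℕ} {ρ : Representation C (GL (Fin n) 𝔽) V} {v : V} :
    v ∈ fixedSub ρ (Nset 𝔽 b) ↔ ∀ g ∈ radical 𝔽 b, ρ g v = v := by
  rw [mem_fixedSub, ← radical_eq_Nset]; rfl

lemma rep_mul_apply {Γ : Type} [Monoid Γ] (ρ : Representation C Γ V) (g h : Γ) (v : V) :
    ρ (g * h) v = ρ g (ρ h v) := by rw [map_mul]; rfl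

lemma rep_one_apply {Γ : Type} [Monoid Γ] (ρ : Representation C Γ V) (v : V) :
    ρ 1 v = v := by rw [map_one]; rfl

/-- The vector `v` is an eigenvector for all diagonal matrices. -/
def IsTorusEigen (ρ : Representation C (GL (Fin n) 𝔽) V) (v : V) : Prop :=
  ∀ d, ∃ c : C, ρ (diagGL d) v = c • v

/-- The Hecke operator `∑ x, u_{ij}(x) s_{ij}` of a root. -/
def heckeOp (ρ : Representation C (GL (Fin n) 𝔽) V) {i j : Fin n} (h : i ≠ j) : V →ₗ[C] V :=
  ∑ x : 𝔽, ρ (elem h x * permGL (Equiv.swap i j))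

lemma heckeOp_apply (ρ : Representation C (GL (Fin n) 𝔽) V) {i j : Fin n} (h : i ≠ j) (v : V) :
    heckeOp ρ h v = ∑ x : 𝔽, ρ (elem h x * permGL (Equiv.swap i j)) v := by
  simp [heckeOp]

lemma swap_mul_diagGL_mul_swap (i j : Fin n) (d : Fin n → 𝔽ˣ) :
    permGL (Equiv.swap i j) * diagGL d * permGL (Equiv.swap i j)
      = diagGL (d ∘ Equiv.swap i j) := by
  ext a c
  show (permGL (Equiv.swap i j) * diagGL d * permGL (Equiv.swap i j)).1 a c
    = (diagGL (d ∘ Equiv.swap i j)).1 a c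
  rw [swap_conj_apply, diagGL_apply, diagGL_apply]
  simp only [EmbeddingLike.apply_eq_iff_eq, Function.comp_apply]

lemma diagGL_mul_elem (d : Fin n → 𝔽ˣ) {i j : Fin n} (h : i ≠ j) (x : 𝔽) :
    diagGL d * elem h x = elem h (d i * x * (d j : 𝔽)⁻¹) * diagGL d := by
  ext a c
  show (diagGL d * elem h x).1 a c = (elem h (d i * x * (d j : 𝔽)⁻¹) * diagGL d).1 a c
  rw [diagGL_mul_apply, mul_diagGL_apply, elem_apply, elem_apply]
  have hj := (d j).ne_zero
  by_cases h1 : a = c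
  · subst h1
    have : ¬ (a = i ∧ a = j) := by rintro ⟨rfl, rfl⟩; exact h rfl
    simp [this]
  · by_cases h2 : a = i ∧ c = j
    · obtain ⟨rfl, rfl⟩ := h2
      simp [h1]
    · simp [h1, h2]

lemma diagGL_heckeOp (ρ : Representation C (GL (Fin n) 𝔽) V) {i j : Fin n} (h : i ≠ j)
    (d : Fin n → 𝔽ˣ) (v : V) :
    ρ (diagGL d) (heckeOp ρ h v) = heckeOp ρ h (ρ (diagGL (d ∘ Equiv.swap i j)) v) := by
  rw [heckeOp_apply, heckeOp_apply, map_sum]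
  refine Fintype.sum_equiv ((Equiv.mulLeft₀ (d i : 𝔽) (d i).ne_zero).trans
    (Equiv.mulRight₀ ((d j : 𝔽)⁻¹) (inv_ne_zero (d j).ne_zero))) _ _ fun x => ?_
  rw [← rep_mul_apply, ← rep_mul_apply, ← swap_mul_diagGL_mul_swap]
  congr 2
  have hs := permGL_swap_mul_self (𝔽 := 𝔽) i j
  rw [← mul_assoc, diagGL_mul_elem]
  change _ = elem h (d i * x * (d j : 𝔽)⁻¹) * _ * _
  simp only [mul_assoc]
  rw [← mul_assoc (permGL (Equiv.swap i j)) (permGL (Equiv.swap i j)), hs, one_mul]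

lemma IsTorusEigen.heckeOp {ρ : Representation C (GL (Fin n) 𝔽) V} {v : V}
    (hv : IsTorusEigen ρ v) {i j : Fin n} (h : i ≠ j) : IsTorusEigen ρ (heckeOp ρ h v) := by
  intro d
  obtain ⟨c, hc⟩ := hv (d ∘ Equiv.swap i j)
  exact ⟨c, by rw [diagGL_heckeOp, hc, map_smul]⟩

lemma heckeOp_mem_fixed {ρ : Representation C (GL (Fin n) 𝔽) V} {v : V}
    (hv : v ∈ fixedSub ρ (Uset 𝔽 n)) {i j : Fin n} (hij : (i : ℕ) + 1 = j) (h : i < j) :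
    heckeOp ρ h.ne v ∈ fixedSub ρ (Uset 𝔽 n) := by
  rw [mem_fixed_unip] at hv ⊢
  intro g hg
  rw [heckeOp_apply, map_sum]
  refine Fintype.sum_equiv (Equiv.addRight (g.1 i j)) _ _ fun x => ?_
  rw [Equiv.coe_addRight]
  set s : GL (Fin n) 𝔽 := permGL (Equiv.swap i j) with hs
  set m := elem h.ne (-(x + g.1 i j)) * g * elem h.ne x with hm
  have hgu := mem_unip.1 hg
  have hmu : m ∈ unip 𝔽 n := mul_mem (mul_mem (elem_mem_unip h _) hg) (elem_mem_unip h _)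
  have hm0 : m.1 i j = 0 := by
    rw [hm, mul_elem_apply, if_pos rfl, elem_mul_apply, elem_mul_apply, if_pos rfl, if_pos rfl,
      hgu.2 i, hgu.2 j, hgu.1 j i h]
    ring
  have key : g * (elem h.ne x * s) = elem h.ne (x + g.1 i j) * s * (s * m * s) := by
    have hss : s * s = 1 := permGL_swap_mul_self i j
    calc g * (elem h.ne x * s)
        = (elem h.ne (x + g.1 i j) * elem h.ne (-(x + g.1 i j))) * g * elem h.ne x * s := by
          rw [elem_mul_elem, add_neg_cancel, elem_zero, one_mul, mul_assoc]
      _ = elem h.ne (x + g.1 i j) * (s * s) * m * s := by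
          rw [hss, hm, mul_one]; simp only [mul_assoc]
      _ = _ := by simp only [mul_assoc]
  rw [← rep_mul_apply, key, rep_mul_apply ρ (_ * s), hv _ (swap_conj_mem_unip hij hmu hm0)]

lemma sum_elem_apply (ρ : Representation C (GL (Fin n) 𝔽) V) {i j : Fin n} (h : i ≠ j) (a : 𝔽)
    (v : V) : ∑ x : 𝔽, ρ (elem h x * elem h a) v = ∑ x : 𝔽, ρ (elem h x) v := by
  refine Fintype.sum_equiv (Equiv.addRight a) _ _ fun x => ?_
  rw [elem_mul_elem]; rfl

lemma sum_eq_zero_add_units (f : 𝔽 → V) : ∑ x : 𝔽, f x = f 0 + ∑ z : 𝔽ˣ, f z := by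
  classical
  rw [← Finset.add_sum_erase _ _ (Finset.mem_univ (0 : 𝔽))]
  congr 1
  symm
  refine Finset.sum_bij (fun z _ => (z : 𝔽)) ?_ ?_ ?_ ?_
  · intro z _; simp
  · intro z _ y _ hzy; exact Units.ext hzy
  · intro z hz
    exact ⟨Units.mk0 z (Finset.ne_of_mem_erase hz), Finset.mem_univ _, rfl⟩
  · intros; rfl

/-- The quadratic relation for Hecke operators in the defining characteristic. -/
lemma heckeOp_sq (hchar : (Fintype.card 𝔽 : C) = 0) (ρ : Representation C (GL (Fin n) 𝔽) V)
    {i j : Fin n} (h : i ≠ j) {v : V} (hv : ∀ x, ρ (elem h x) v = v) :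
    heckeOp ρ h (heckeOp ρ h v) = ∑ z : 𝔽ˣ, ρ (corootGL i j z) (heckeOp ρ h v) := by
  classical
  have hss := permGL_swap_mul_self (𝔽 := 𝔽) i j
  set s : GL (Fin n) 𝔽 := permGL (Equiv.swap i j) with hs
  have hterm : ∀ z : 𝔽, ∑ x : 𝔽, ρ (elem h x * s) (ρ (elem h z * s) v)
      = ∑ x : 𝔽, ρ (elem h x) (ρ (elem h.symm z) v) := by
    intro z
    refine Finset.sum_congr rfl fun x _ => ?_
    rw [← rep_mul_apply, ← rep_mul_apply, ← swap_conj_elem h]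
    congr 2
    simp only [mul_assoc, ← hs]
  have h0 : ∑ x : 𝔽, ρ (elem h x) (ρ (elem h.symm (0 : 𝔽)) v) = 0 := by
    simp only [elem_zero, map_one, Module.End.one_apply, hv, Finset.sum_const, Finset.card_univ]
    rw [← Nat.cast_smul_eq_nsmul C, hchar, zero_smul]
  have hz : ∀ z : 𝔽ˣ, ∑ x : 𝔽, ρ (elem h x) (ρ (elem h.symm (z : 𝔽)) v)
      = ρ (corootGL i j z) (heckeOp ρ h v) := by
    intro z
    simp only [← rep_mul_apply]
    rw [elem_eq_bigCell h z, ← hs]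
    set a : 𝔽 := ((z⁻¹ : 𝔽ˣ) : 𝔽)
    have : ∀ x : 𝔽, ρ (elem h x * (elem h a * corootGL i j z * s * elem h a)) v
        = ρ (elem h x * elem h a) (ρ (corootGL i j z * s) v) := by
      intro x
      rw [← mul_assoc, rep_mul_apply, hv, ← rep_mul_apply]
      simp only [mul_assoc]
    simp only [this]
    rw [sum_elem_apply, heckeOp_apply, map_sum]
    symm
    unfold corootGL
    set d : Fin n → 𝔽ˣ := fun k => if k = i then -z⁻¹ else if k = j then z else 1
    refine Fintype.sum_equiv ((Equiv.mulLeft₀ (d i : 𝔽) (d i).ne_zero).trans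
      (Equiv.mulRight₀ ((d j : 𝔽)⁻¹) (inv_ne_zero (d j).ne_zero))) _ _ fun x => ?_
    rw [← rep_mul_apply, ← rep_mul_apply, ← mul_assoc, diagGL_mul_elem, mul_assoc]
    rfl
  rw [heckeOp_apply, heckeOp_apply ρ h v]
  simp only [map_sum]
  rw [Finset.sum_comm, ← hs]
  simp only [hterm]
  rw [sum_eq_zero_add_units, h0, zero_add]
  refine Finset.sum_congr rfl fun z _ => ?_
  rw [hz, heckeOp_apply, map_sum]

/-- The operator `∑ u, u w` with `u` running over `U ∩ w U⁻ w⁻¹`. -/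
def weylSum (ρ : Representation C (GL (Fin n) 𝔽) V) (w : Equiv.Perm (Fin n)) (v : V) : V :=
  ∑ u ∈ invUnipFin 𝔽 w, ρ (u * permGL w) v

lemma weylSum_one (ρ : Representation C (GL (Fin n) 𝔽) V) (v : V) : weylSum ρ 1 v = v := by
  have : invUnipFin 𝔽 (1 : Equiv.Perm (Fin n)) = {1} := by
    ext u
    rw [mem_invUnipFin, Finset.mem_singleton, mem_invUnip]
    simp only [map_one, inv_one, one_mul, mul_one]
    constructor
    · rintro ⟨h1, h2⟩
      rw [mem_unip] at h1
      rw [mem_lowerUnip_iff] at h2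
      ext i j
      rw [Units.val_one, Matrix.one_apply]
      split_ifs with h
      · subst h; exact h1.2 i
      · rcases lt_or_gt_of_ne h with h | h
        · exact h2.1 i j h
        · exact h1.1 i j h
    · rintro rfl; exact ⟨one_mem _, one_mem _⟩
  rw [weylSum, this, Finset.sum_singleton, map_one, mul_one, map_one]; rfl

lemma heckeOp_weylSum (ρ : Representation C (GL (Fin n) 𝔽) V) {i j : Fin n}
    (hij : (i : ℕ) + 1 = j) (h : i < j) {w : Equiv.Perm (Fin n)} (hw : w⁻¹ i < w⁻¹ j) (v : V) :
    heckeOp ρ h.ne (weylSum ρ w v) = weylSum ρ (Equiv.swap i j * w) v := by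
  rw [weylSum, weylSum, sum_invUnip_swap hij h hw, heckeOp_apply]
  refine Finset.sum_congr rfl fun x _ => ?_
  rw [map_sum]
  refine Finset.sum_congr rfl fun u _ => ?_
  rw [← rep_mul_apply, map_mul (permGL (𝔽 := 𝔽))]
  congr 2
  have hss := permGL_swap_mul_self (𝔽 := 𝔽) i j
  simp only [mul_assoc]
  rw [← mul_assoc (permGL (Equiv.swap i j)) (permGL (Equiv.swap i j)), hss, one_mul]

lemma weylSum_mem_fixed {ρ : Representation C (GL (Fin n) 𝔽) V} {v : V}
    (hv : v ∈ fixedSub ρ (Uset 𝔽 n)) (w : Equiv.Perm (Fin n)) :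
    weylSum ρ w v ∈ fixedSub ρ (Uset 𝔽 n) := by
  induction w using perm_ascent_induction with
  | one => rwa [weylSum_one]
  | step w i j hij hw ih =>
    have h : i < j := by rw [Fin.lt_def]; omega
    rw [← heckeOp_weylSum ρ hij h hw]
    exact heckeOp_mem_fixed ih hij h

lemma IsTorusEigen.weylSum {ρ : Representation C (GL (Fin n) 𝔽) V} {v : V}
    (hv : IsTorusEigen ρ v) (w : Equiv.Perm (Fin n)) : IsTorusEigen ρ (weylSum ρ w v) := by
  induction w using perm_ascent_induction with
  | one => rwa [weylSum_one]
  | step w i j hij hw ih =>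
    have h : i < j := by rw [Fin.lt_def]; omega
    rw [← heckeOp_weylSum ρ hij h hw]
    exact ih.heckeOp h.ne

/-- For descents of `w`, the operator `weylSum ρ w` absorbs the Hecke operator up to the torus. -/
lemma heckeOp_weylSum_of_descent (hchar : (Fintype.card 𝔽 : C) = 0)
    (ρ : Representation C (GL (Fin n) 𝔽) V) {i j : Fin n}
    (hij : (i : ℕ) + 1 = j) (h : i < j) {w : Equiv.Perm (Fin n)} (hw : w⁻¹ j < w⁻¹ i) {v : V}
    (hv : v ∈ fixedSub ρ (Uset 𝔽 n)) :
    heckeOp ρ h.ne (weylSum ρ w v) = ∑ z : 𝔽ˣ, ρ (corootGL i j z) (weylSum ρ w v) := by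
  have hw' : (Equiv.swap i j * w)⁻¹ i < (Equiv.swap i j * w)⁻¹ j := by
    rw [_root_.mul_inv_rev, Equiv.swap_inv, Equiv.Perm.mul_apply, Equiv.Perm.mul_apply,
      Equiv.swap_apply_left, Equiv.swap_apply_right]
    exact hw
  have hss : Equiv.swap i j * (Equiv.swap i j * w) = w := by
    rw [← mul_assoc, Equiv.swap_mul_self, one_mul]
  have h1 := heckeOp_weylSum ρ hij h hw' v
  rw [hss] at h1
  rw [← h1]
  refine heckeOp_sq hchar ρ h.ne fun x => ?_
  exact mem_fixed_unip.1 (weylSum_mem_fixed hv _) _ (elem_mem_unip h x)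

lemma IsTorusEigen.exists_sum_coroot {ρ : Representation C (GL (Fin n) 𝔽) V} {v : V}
    (hv : IsTorusEigen ρ v) (i j : Fin n) :
    ∃ c : C, ∑ z : 𝔽ˣ, ρ (corootGL i j z) v = c • v := by
  choose c hc using fun z : 𝔽ˣ => hv (fun k => if k = i then -z⁻¹ else if k = j then z else 1)
  exact ⟨∑ z, c z, by rw [Finset.sum_smul]; exact Finset.sum_congr rfl fun z _ => hc z⟩

/-- Existence of simultaneous eigenvectors for the Hecke operators. -/
lemma exists_hecke_eigen (hchar : (Fintype.card 𝔽 : C) = 0)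
    (ρ : Representation C (GL (Fin n) 𝔽) V) {v : V} (hv0 : v ≠ 0)
    (hv : v ∈ fixedSub ρ (Uset 𝔽 n)) (hT : IsTorusEigen ρ v) :
    ∃ v' ≠ 0, v' ∈ fixedSub ρ (Uset 𝔽 n) ∧ IsTorusEigen ρ v' ∧
      ∀ (i j : Fin n) (h : i < j), (i : ℕ) + 1 = j → ∃ c : C, heckeOp ρ h.ne v' = c • v' := by
  classical
  obtain ⟨w, hw, hmax⟩ := Finset.exists_max_image
    (Finset.univ.filter fun w : Equiv.Perm (Fin n) => weylSum ρ w v ≠ 0)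
    (fun w => (invUnipFin 𝔽 w).card)
    ⟨1, by simpa [weylSum_one] using hv0⟩
  rw [Finset.mem_filter] at hw
  refine ⟨weylSum ρ w v, hw.2, weylSum_mem_fixed hv w, hT.weylSum w, fun i j h hij => ?_⟩
  rcases lt_or_gt_of_ne ((w⁻¹ : Equiv.Perm (Fin n)).injective.ne h.ne) with hlt | hgt
  · refine ⟨0, ?_⟩
    rw [heckeOp_weylSum ρ hij h hlt, zero_smul]
    by_contra hne
    have := hmax _ (Finset.mem_filter.2 ⟨Finset.mem_univ _, hne⟩)
    exact absurd (card_invUnip_swap_lt 𝔽 hij hlt) (not_lt.2 this)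
  · rw [heckeOp_weylSum_of_descent hchar ρ hij h hgt hv]
    exact (hT.weylSum w).exists_sum_coroot i j

end

section

variable {Γ : Type} [Group Γ] {C : Type} [Field C] {V : Type} [AddCommGroup V] [Module C V]

lemma exists_fixed_of_isPGroup_of_module {p : ℕ} [Fact p.Prime] [Module (ZMod p) V]
    (hp : ∀ x : V, p • x = 0) (ρ : Representation C Γ V)
    (H : Subgroup Γ) [Finite H] (hH : IsPGroup p H) (S : Submodule C V) (hS : S ≠ ⊥)
    (hstab : ∀ g ∈ H, ∀ v ∈ S, ρ g v ∈ S) :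
    ∃ v ∈ S, v ≠ 0 ∧ ∀ g ∈ H, ρ g v = v := by
  obtain ⟨v₀, hv₀, hne⟩ := Submodule.exists_mem_ne_zero_of_ne_bot hS
  let X : Submodule (ZMod p) V := Submodule.span (ZMod p) (Set.range fun g : H => ρ g v₀)
  have : Module.Finite (ZMod p) ↥X :=
    Module.Finite.span_of_finite (ZMod p) (Set.finite_range fun g : H => ρ g v₀)
  have : Finite X := Module.finite_of_finite (ZMod p)
  have hXS : ∀ x ∈ X, x ∈ S := by
    intro x hx
    induction hx using Submodule.span_induction with
    | mem x hx => obtain ⟨g, rfl⟩ := hx; exact hstab g g.2 _ hv₀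
    | zero => exact S.zero_mem
    | add x y _ _ hx hy => exact S.add_mem hx hy
    | smul c x _ hx =>
      rw [← ZMod.natCast_zmod_val c, Nat.cast_smul_eq_nsmul]
      exact S.nsmul_mem hx _
  have hXstab : ∀ (g : H) (x : V), x ∈ X → ρ g x ∈ X := by
    intro g x hx
    induction hx using Submodule.span_induction with
    | mem x hx =>
      obtain ⟨k, rfl⟩ := hx
      refine Submodule.subset_span ⟨g * k, ?_⟩
      simp [map_mul]
    | zero => rw [map_zero]; exact X.zero_mem
    | add x y _ _ hx hy => rw [map_add]; exact X.add_mem hx hy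
    | smul c x _ hx =>
      rw [← ZMod.natCast_zmod_val c, Nat.cast_smul_eq_nsmul, map_nsmul]
      exact X.nsmul_mem hx _
  let _ : MulAction H X :=
    { smul := fun g x => ⟨ρ g x, hXstab g x x.2⟩
      one_smul := fun x => Subtype.ext (by
        change ρ ((1 : H) : Γ) x = x
        rw [Subgroup.coe_one, map_one]; rfl)
      mul_smul := fun g h x => Subtype.ext (by
        change ρ ((g * h : H) : Γ) x = ρ g (ρ h x)
        rw [Subgroup.coe_mul, map_mul]; rfl) }
  have hv₀X : v₀ ∈ X := Submodule.subset_span ⟨1, by simp⟩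
  have hcard : p ∣ Nat.card X := by
    have h1 : p • (⟨v₀, hv₀X⟩ : X) = 0 := Subtype.ext (hp v₀)
    have h2 : addOrderOf (⟨v₀, hv₀X⟩ : X) = p :=
      addOrderOf_eq_prime h1 fun h => hne (congrArg Subtype.val h)
    exact h2.symm.dvd.trans (addOrderOf_dvd_natCard _)
  have h0 : (0 : X) ∈ MulAction.fixedPoints H X := fun g => Subtype.ext (map_zero (ρ g))
  obtain ⟨x, hx, hx0⟩ := hH.exists_fixed_point_of_prime_dvd_card_of_fixed_point X hcard h0
  exact ⟨x, hXS x x.2, fun h => hx0 (Subtype.ext h.symm),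
    fun g hg => congrArg Subtype.val (hx ⟨g, hg⟩)⟩

/-- A finite `p`-group acting on a nonzero space in characteristic `p` fixes a nonzero vector. -/
lemma exists_fixed_of_isPGroup {p : ℕ} [Fact p.Prime] [CharP C p] (ρ : Representation C Γ V)
    (H : Subgroup Γ) [Finite H] (hH : IsPGroup p H) (S : Submodule C V) (hS : S ≠ ⊥)
    (hstab : ∀ g ∈ H, ∀ v ∈ S, ρ g v ∈ S) :
    ∃ v ∈ S, v ≠ 0 ∧ ∀ g ∈ H, ρ g v = v := by
  have hp : ∀ x : V, p • x = 0 := fun x => by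
    rw [← Nat.cast_smul_eq_nsmul C, CharP.cast_eq_zero, zero_smul]
  exact @exists_fixed_of_isPGroup_of_module Γ _ C _ V _ _ p _ (AddCommGroup.zmodModule hp) hp
    ρ H _ hH S hS hstab

/-- Irreducible representations of finite groups are finite-dimensional. -/
lemma _root_.IsIrredRep.finiteDimensional [Finite Γ] {ρ : Representation C Γ V} (h : IsIrredRep ρ) :
    FiniteDimensional C V := by
  obtain ⟨hnt, hirr⟩ := h
  obtain ⟨v, hv⟩ := exists_ne (0 : V)
  let X : Submodule C V := Submodule.span C (Set.range fun g => ρ g v)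
  have hX : X = ⊤ := by
    refine (hirr X fun g x hx => ?_).resolve_left fun hbot => hv ?_
    · induction hx using Submodule.span_induction with
      | mem x hx =>
        obtain ⟨k, rfl⟩ := hx
        refine Submodule.subset_span ⟨g * k, ?_⟩
        simp [map_mul]
      | zero => rw [map_zero]; exact X.zero_mem
      | add x y _ _ hx hy => rw [map_add]; exact X.add_mem hx hy
      | smul c x _ hx => rw [map_smul]; exact X.smul_mem _ hx
    · have : v ∈ X := Submodule.subset_span ⟨1, by simp⟩
      rwa [hbot, Submodule.mem_bot] at this
  exact ⟨by rw [← hX]; exact Submodule.fg_span (Set.finite_range _)⟩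

/-- Commuting operators on a finite-dimensional space over an algebraically closed field have a
common eigenvector. -/
lemma exists_common_eigenvector [IsAlgClosed C] {A : Type} [CommMonoid A]
    (ρ : Representation C A V) (S : Submodule C V) [FiniteDimensional C S] (hS : S ≠ ⊥)
    (hstab : ∀ a, ∀ v ∈ S, ρ a v ∈ S) :
    ∃ v ∈ S, v ≠ 0 ∧ ∀ a, ∃ c : C, ρ a v = c • v := by
  induction hd : Module.finrank C S using Nat.strong_induction_on generalizing S with
  | _ d ih =>
  by_cases hscal : ∀ a, ∃ c : C, ∀ v ∈ S, ρ a v = c • v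
  · obtain ⟨v, hv, hv0⟩ := Submodule.exists_mem_ne_zero_of_ne_bot hS
    exact ⟨v, hv, hv0, fun a => (hscal a).imp fun c hc => hc v hv⟩
  · push Not at hscal
    obtain ⟨a, ha⟩ := hscal
    have : Nontrivial S := Submodule.nontrivial_iff_ne_bot.2 hS
    obtain ⟨c, hc⟩ := Module.End.exists_eigenvalue ((ρ a).restrict (hstab a))
    obtain ⟨v, hv⟩ := hc.exists_hasEigenvector
    let T : Submodule C V := S ⊓ Module.End.eigenspace (ρ a) c
    have hTS : T ≤ S := inf_le_left
    have : FiniteDimensional C T := Submodule.finiteDimensional_of_le hTS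
    have hvT : (v : V) ∈ T := by
      refine ⟨v.2, Module.End.mem_eigenspace_iff.2 ?_⟩
      exact congrArg Subtype.val hv.apply_eq_smul
    have hT : T ≠ ⊥ := fun h => hv.2 (Subtype.ext (by rwa [h, Submodule.mem_bot] at hvT))
    have hlt : Module.finrank C T < d := by
      rw [← hd]
      refine Submodule.finrank_lt_finrank_of_lt (lt_of_le_of_ne hTS fun h => ?_)
      obtain ⟨x, hx, hx'⟩ := ha c
      rw [← h] at hx
      exact hx' (Module.End.mem_eigenspace_iff.1 hx.2)
    obtain ⟨x, hx, hx0, hxe⟩ := ih _ hlt T hT (fun b x hx => ⟨hstab b x hx.1, by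
      rw [SetLike.mem_coe, Module.End.mem_eigenspace_iff, ← rep_mul_apply, mul_comm, rep_mul_apply,
        Module.End.mem_eigenspace_iff.1 hx.2, map_smul]⟩) rfl
    exact ⟨x, hTS hx, hx0, hxe⟩

variable {𝔽 : Type} [Field 𝔽] [Fintype 𝔽] {n : ℕ}

lemma isPGroup_unip (p : ℕ) [Fact p.Prime] [CharP 𝔽 p] : IsPGroup p (unip 𝔽 n) := by
  rintro ⟨g, hg⟩
  rw [mem_unip] at hg
  refine ⟨n, Subtype.ext (Units.ext ?_)⟩
  change (g : Matrix (Fin n) (Fin n) 𝔽) ^ p ^ n = 1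
  have htri : (g : Matrix (Fin n) (Fin n) 𝔽).BlockTriangular id := fun i j h => hg.1 i j h
  have hcp := Matrix.charpoly_of_isUpperTriangular _ htri
  simp only [hg.2, map_one, Finset.prod_const, Finset.card_univ, Fintype.card_fin] at hcp
  have h1 := Matrix.aeval_self_charpoly (g : Matrix (Fin n) (Fin n) 𝔽)
  rw [hcp] at h1
  simp only [map_pow, map_sub, Polynomial.aeval_X, map_one] at h1
  rcases Nat.eq_zero_or_pos n with rfl | hn
  · ext i; exact i.elim0
  have : Nonempty (Fin n) := ⟨⟨0, hn⟩⟩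
  have : CharP (Matrix (Fin n) (Fin n) 𝔽) p := inferInstance
  have h2 := sub_pow_char_pow_of_commute (p := p) (n := n) (Commute.one_right (g : Matrix (Fin n) (Fin n) 𝔽))
  rw [pow_eq_zero_of_le (Nat.lt_pow_self (Fact.out : p.Prime).one_lt).le h1, one_pow] at h2
  exact (sub_eq_zero.1 h2.symm)

end

section

variable {𝔽 : Type} [Field 𝔽] [Fintype 𝔽] {n : ℕ} {C : Type} [Field C]
  {V : Type} [AddCommGroup V] [Module C V]

lemma elem_mul_swap {i j : Fin n} (h : i ≠ j) (z : 𝔽ˣ) :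
    elem h (z : 𝔽) * permGL (Equiv.swap i j) =
      elem h.symm ((z⁻¹ : 𝔽ˣ) : 𝔽) * corootGL j i z * elem h ((z⁻¹ : 𝔽ˣ) : 𝔽) := by
  have h1 := elem_eq_bigCell h.symm z
  have h2 := swap_conj_elem h.symm ((z⁻¹ : 𝔽ˣ) : 𝔽)
  rw [Equiv.swap_comm] at h1 h2
  rw [h1, ← h2]
  simp only [mul_assoc]

lemma swap_mul_elem {i j : Fin n} (h : i ≠ j) (x : 𝔽) :
    permGL (Equiv.swap i j) * elem h.symm x = elem h x * permGL (Equiv.swap i j) := by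
  have h2 := swap_conj_elem h.symm x
  rw [Equiv.swap_comm] at h2
  rw [← h2, mul_assoc _ (permGL (Equiv.swap i j)), permGL_swap_mul_self, mul_one]

lemma elem_swap_apply (ρ : Representation C (GL (Fin n) 𝔽) V) {v : V}
    {i j : Fin n} (h : i ≠ j) (hfix : ∀ x, ρ (elem h x) v = v) (z : 𝔽ˣ) :
    ρ (elem h (z : 𝔽) * permGL (Equiv.swap i j)) v
      = ρ (elem h.symm ((z⁻¹ : 𝔽ˣ) : 𝔽)) (ρ (corootGL j i z) v) := by
  rw [elem_mul_swap, rep_mul_apply, hfix, rep_mul_apply]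

lemma heckeOp_eq_swap_add (ρ : Representation C (GL (Fin n) 𝔽) V) {v : V}
    {i j : Fin n} (h : i ≠ j) (hfix : ∀ x, ρ (elem h x) v = v) :
    heckeOp ρ h v = ρ (permGL (Equiv.swap i j)) v
      + ∑ z : 𝔽ˣ, ρ (elem h.symm ((z⁻¹ : 𝔽ˣ) : 𝔽)) (ρ (corootGL j i z) v) := by
  rw [heckeOp_apply, sum_eq_zero_add_units, elem_zero, one_mul]
  simp only [elem_swap_apply ρ h hfix]

/-- The span of the translates of `v` by lower unitriangular matrices. -/
def lowerSpan (ρ : Representation C (GL (Fin n) 𝔽) V) (v : V) : Submodule C V :=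
  Submodule.span C ((fun g => ρ g v) '' (lowerUnip 𝔽 n : Set (GL (Fin n) 𝔽)))

lemma apply_mem_lowerSpan (ρ : Representation C (GL (Fin n) 𝔽) V) (v : V)
    {g : GL (Fin n) 𝔽} (hg : g ∈ lowerUnip 𝔽 n) : ρ g v ∈ lowerSpan ρ v :=
  Submodule.subset_span ⟨g, hg, rfl⟩

lemma self_mem_lowerSpan (ρ : Representation C (GL (Fin n) 𝔽) V) (v : V) : v ∈ lowerSpan ρ v := by
  simpa using apply_mem_lowerSpan ρ v (one_mem _)

lemma lowerSpan_stable_of (ρ : Representation C (GL (Fin n) 𝔽) V) (v : V) {g : GL (Fin n) 𝔽}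
    (h : ∀ u ∈ lowerUnip 𝔽 n, ρ g (ρ u v) ∈ lowerSpan ρ v) {x : V} (hx : x ∈ lowerSpan ρ v) :
    ρ g x ∈ lowerSpan ρ v := by
  induction hx using Submodule.span_induction with
  | mem x hx => obtain ⟨u, hu, rfl⟩ := hx; exact h u hu
  | zero => rw [map_zero]; exact Submodule.zero_mem _
  | add x y _ _ hx hy => rw [map_add]; exact Submodule.add_mem _ hx hy
  | smul c x _ hx => rw [map_smul]; exact Submodule.smul_mem _ _ hx

lemma lowerSpan_stable_lower (ρ : Representation C (GL (Fin n) 𝔽) V) (v : V) {g : GL (Fin n) 𝔽}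
    (hg : g ∈ lowerUnip 𝔽 n) {x : V} (hx : x ∈ lowerSpan ρ v) : ρ g x ∈ lowerSpan ρ v := by
  refine lowerSpan_stable_of ρ v (fun u hu => ?_) hx
  rw [← rep_mul_apply]
  exact apply_mem_lowerSpan ρ v (mul_mem hg hu)

/-- A simultaneous eigenvector of torus and Hecke operators generates a representation
which is already generated under lower unitriangular matrices. -/
lemma lowerSpan_stable {ρ : Representation C (GL (Fin n) 𝔽) V} {v : V}
    (hv : v ∈ fixedSub ρ (Uset 𝔽 n)) (hT : IsTorusEigen ρ v)
    (hH : ∀ (i j : Fin n) (h : i < j), (i : ℕ) + 1 = j → ∃ c : C, heckeOp ρ h.ne v = c • v)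
    (g : GL (Fin n) 𝔽) : ∀ x ∈ lowerSpan ρ v, ρ g x ∈ lowerSpan ρ v := by
  have hfix := mem_fixed_unip.1 hv
  let Q : Submonoid (GL (Fin n) 𝔽) :=
    { carrier := {g | ∀ x ∈ lowerSpan ρ v, ρ g x ∈ lowerSpan ρ v}
      one_mem' := fun x hx => by rwa [rep_one_apply]
      mul_mem' := fun {a b} ha hb x hx => by rw [rep_mul_apply]; exact ha _ (hb _ hx) }
  have hswap : ∀ i j : Fin n, (i : ℕ) + 1 = j → permGL (Equiv.swap i j) ∈ Q := by
    intro i j hij x hx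
    have h : i < j := by rw [Fin.lt_def]; omega
    refine lowerSpan_stable_of ρ v (fun u hu => ?_) hx
    set y := u.1 j i with hy
    have hu' := mem_lowerUnip_iff.1 hu
    set m := u * elem h.ne' (-y) with hm
    have hml : m ∈ lowerUnip 𝔽 n := mul_mem hu (elem_mem_lowerUnip h _)
    have hm0 : m.1 j i = 0 := by
      rw [hm, mul_elem_apply, if_pos rfl, hu'.2 j, one_mul, ← hy, add_neg_cancel]
    have key : permGL (Equiv.swap i j) * u
        = permGL (Equiv.swap i j) * m * permGL (Equiv.swap i j)
          * (elem h.ne y * permGL (Equiv.swap i j)) := by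
      rw [← swap_mul_elem h.ne y, mul_assoc _ _ (_ * _), ← mul_assoc _ _ (elem h.ne' y),
        permGL_swap_mul_self, one_mul, hm, mul_assoc, mul_assoc u, elem_mul_elem,
        neg_add_cancel, elem_zero, mul_one]
    rw [← rep_mul_apply, key, rep_mul_apply]
    refine lowerSpan_stable_lower ρ v (swap_conj_mem_lowerUnip hij hml hm0) ?_
    have hunit : ∀ z : 𝔽ˣ, ρ (elem h.ne'  ((z⁻¹ : 𝔽ˣ) : 𝔽)) (ρ (corootGL j i z) v)
        ∈ lowerSpan ρ v := by
      intro z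
      obtain ⟨c, hc⟩ := hT (fun k => if k = j then -z⁻¹ else if k = i then z else 1)
      rw [corootGL, hc, map_smul]
      exact Submodule.smul_mem _ _ (apply_mem_lowerSpan ρ v (elem_mem_lowerUnip h _))
    have hfix' : ∀ x, ρ (elem h.ne x) v = v := fun x => hfix _ (elem_mem_unip h x)
    by_cases hy0 : y = 0
    · obtain ⟨c, hc⟩ := hH i j h hij
      rw [heckeOp_eq_swap_add ρ h.ne hfix', ← eq_sub_iff_add_eq] at hc
      rw [hy0, elem_zero, one_mul, hc]
      exact Submodule.sub_mem _ (Submodule.smul_mem _ _ (self_mem_lowerSpan ρ v))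
        (Submodule.sum_mem _ fun z _ => hunit z)
    · have := elem_swap_apply ρ h.ne hfix' (Units.mk0 y hy0)
      rw [Units.val_mk0] at this
      rw [this]
      exact hunit _
  refine mem_of_generators Q hswap ?_ ?_ g
  · intro d x hx
    refine lowerSpan_stable_of ρ v (fun u hu => ?_) hx
    obtain ⟨c, hc⟩ := hT d
    have key : diagGL d * u = ((diagGL d⁻¹)⁻¹ * u * diagGL d⁻¹) * diagGL d := by
      rw [map_inv, inv_inv, inv_mul_cancel_right]
    rw [← rep_mul_apply, key, rep_mul_apply, hc, map_smul]
    exact Submodule.smul_mem _ _ (apply_mem_lowerSpan ρ v (conj_diag_mem_lowerUnip _ hu))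
  · intro i j h hij x
    have h2 := swap_conj_elem h.ne' x
    rw [Equiv.swap_comm] at h2
    rw [← h2]
    exact Q.mul_mem (Q.mul_mem (hswap i j hij)
      (fun y hy => lowerSpan_stable_lower ρ v (elem_mem_lowerUnip h x) hy)) (hswap i j hij)

lemma fixed_torus_stable {ρ : Representation C (GL (Fin n) 𝔽) V} {v : V}
    (hv : v ∈ fixedSub ρ (Uset 𝔽 n)) (d : Fin n → 𝔽ˣ) :
    ρ (diagGL d) v ∈ fixedSub ρ (Uset 𝔽 n) := by
  rw [mem_fixed_unip] at hv ⊢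
  intro g hg
  have := hv _ (conj_diag_mem_unip d hg)
  rw [← rep_mul_apply]
  conv_rhs => rw [← this]
  rw [← rep_mul_apply]
  congr 2
  group

/-- An irreducible representation in the defining characteristic is spanned by the translates of a
single `U`-fixed vector under lower unitriangular matrices. -/
lemma _root_.IsIrredRep.exists_lowerSpan_eq_top {p : ℕ} [Fact p.Prime] [CharP 𝔽 p] [CharP C p]
    [IsAlgClosed C] {ρ : Representation C (GL (Fin n) 𝔽) V} (hρ : IsIrredRep ρ) :
    ∃ v ≠ 0, v ∈ fixedSub ρ (Uset 𝔽 n) ∧ IsTorusEigen ρ v ∧ lowerSpan ρ v = ⊤ ∧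
      ∀ (i j : Fin n) (h : i < j), (i : ℕ) + 1 = j → ∃ c : C, heckeOp ρ h.ne v = c • v := by
  have hfd := hρ.finiteDimensional
  have hchar : (Fintype.card 𝔽 : C) = 0 := by
    rw [CharP.cast_eq_zero_iff C p, ← CharP.cast_eq_zero_iff 𝔽 p]
    exact FiniteField.cast_card_eq_zero 𝔽
  have hnt := hρ.1
  obtain ⟨v, -, hv0, hv⟩ := exists_fixed_of_isPGroup ρ (unip 𝔽 n) (isPGroup_unip p) ⊤
    top_ne_bot fun _ _ _ _ => trivial
  have hne : fixedSub ρ (Uset 𝔽 n) ≠ ⊥ := fun h => hv0 (by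
    rw [← Submodule.mem_bot C, ← h]; exact mem_fixed_unip.2 hv)
  obtain ⟨v₁, hv₁, hv₁0, hT₁⟩ := exists_common_eigenvector (ρ.comp diagGL)
    (fixedSub ρ (Uset 𝔽 n)) hne fun d v hv => fixed_torus_stable hv d
  obtain ⟨v₂, hv₂0, hv₂, hT₂, hH₂⟩ := exists_hecke_eigen hchar ρ hv₁0 hv₁ hT₁
  refine ⟨v₂, hv₂0, hv₂, hT₂, ?_, hH₂⟩
  refine (hρ.2 _ fun g x hx => lowerSpan_stable hv₂ hT₂ hH₂ g x hx).resolve_left fun h => hv₂0 ?_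
  rw [← Submodule.mem_bot C, ← h]
  exact self_mem_lowerSpan ρ v₂

end

section

variable {𝔽 : Type} [Field 𝔽] [Fintype 𝔽] {n : ℕ} {C : Type} [Field C]
  {V : Type} [AddCommGroup V] [Module C V]

/-- The dual representation twisted by the transposition anti-automorphism. -/
def dualRep (ρ : Representation C (GL (Fin n) 𝔽) V) :
    Representation C (GL (Fin n) 𝔽) (Module.Dual C V) where
  toFun g := (ρ (transp g)).dualMap
  map_one' := by rw [transp_one, map_one]; rfl
  map_mul' g h := by rw [transp_mul, map_mul]; rfl

lemma dualRep_apply (ρ : Representation C (GL (Fin n) 𝔽) V) (g : GL (Fin n) 𝔽)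
    (f : Module.Dual C V) (v : V) : dualRep ρ g f v = f (ρ (transp g) v) := rfl

lemma _root_.IsIrredRep.dualRep {ρ : Representation C (GL (Fin n) 𝔽) V} (hρ : IsIrredRep ρ) :
    IsIrredRep (dualRep ρ) := by
  have hfd := hρ.finiteDimensional
  obtain ⟨hnt, hirr⟩ := hρ
  refine ⟨inferInstance, fun S hS => ?_⟩
  have hstab : ∀ (g : GL (Fin n) 𝔽) (v : V),
      v ∈ S.dualCoannihilator → ρ g v ∈ S.dualCoannihilator := by
    intro g v hv
    rw [Submodule.mem_dualCoannihilator] at hv ⊢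
    intro f hf
    exact hv _ (hS (transp g) f hf)
  have hS' := Subspace.dualCoannihilator_dualAnnihilator_eq (W := S)
  rcases hirr _ hstab with h | h
  · right; rw [← hS', h, Submodule.dualAnnihilator_bot]
  · left; rw [← hS', h, Submodule.dualAnnihilator_top]

/-- The subspace spanned by the translates of `v` under the Levi subgroup. -/
def leviSpan (b : Fin n → ℕ) (ρ : Representation C (GL (Fin n) 𝔽) V) (v : V) : Submodule C V :=
  Submodule.span C ((fun g => ρ g v) '' (Mgrp 𝔽 b : Set (GL (Fin n) 𝔽)))

lemma apply_mem_leviSpan {b : Fin n → ℕ} (ρ : Representation C (GL (Fin n) 𝔽) V) (v : V)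
    {m : GL (Fin n) 𝔽} (hm : m ∈ Mgrp 𝔽 b) : ρ m v ∈ leviSpan b ρ v :=
  Submodule.subset_span ⟨m, hm, rfl⟩

lemma parabolic_apply_mem_fixed {b : Fin n → ℕ} {ρ : Representation C (GL (Fin n) 𝔽) V} {v : V}
    (hv : v ∈ fixedSub ρ (Nset 𝔽 b)) {g : GL (Fin n) 𝔽} (hg : g ∈ parabolic 𝔽 b) :
    ρ g v ∈ fixedSub ρ (Nset 𝔽 b) := by
  rw [mem_fixed_radical] at hv ⊢
  intro x hx
  have h1 := hv _ (conj_mem_radical hg hx)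
  have h2 : x * g = g * (g⁻¹ * x * g) := by group
  rw [← rep_mul_apply, h2, rep_mul_apply, h1]

lemma fixed_unip_le_fixed_radical {b : Fin n → ℕ} (hb : Monotone b)
    (ρ : Representation C (GL (Fin n) 𝔽) V) :
    fixedSub ρ (Uset 𝔽 n) ≤ fixedSub ρ (Nset 𝔽 b) := fun v hv => by
  rw [mem_fixed_unip] at hv
  rw [mem_fixed_radical]
  exact fun g hg => hv g (radical_le_unip hb hg)

lemma leviSpan_le_fixed {b : Fin n → ℕ} {ρ : Representation C (GL (Fin n) 𝔽) V} {v : V}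
    (hv : v ∈ fixedSub ρ (Nset 𝔽 b)) : leviSpan b ρ v ≤ fixedSub ρ (Nset 𝔽 b) := by
  refine Submodule.span_le.2 ?_
  rintro _ ⟨m, hm, rfl⟩
  exact parabolic_apply_mem_fixed hv (Mgrp_le_parabolic b hm)

/-- A functional fixed by `N` is determined by its values on the Levi translates of a vector
generating the representation under lower unitriangular matrices. -/
lemma eq_zero_of_leviSpan {b : Fin n → ℕ} (hb : Monotone b)
    {ρ : Representation C (GL (Fin n) 𝔽) V} {v : V} (htop : lowerSpan ρ v = ⊤)
    {f : Module.Dual C V} (hf : f ∈ fixedSub (dualRep ρ) (Nset 𝔽 b))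
    (h0 : ∀ x ∈ leviSpan b ρ v, f x = 0) : f = 0 := by
  rw [mem_fixed_radical] at hf
  ext x
  have hx : x ∈ lowerSpan ρ v := htop ▸ Submodule.mem_top
  induction hx using Submodule.span_induction with
  | mem x hx =>
    obtain ⟨u, hu, rfl⟩ := hx
    obtain ⟨y, hy, hyu⟩ := exists_levi_mul_radical (unip_le_parabolic hb (mem_lowerUnip.1 hu))
    set l := leviProj b ⟨transp u, unip_le_parabolic hb (mem_lowerUnip.1 hu)⟩ with hl
    have hlM : l ∈ Mgrp 𝔽 b := leviProj_mem b _
    have hlM' : transp l ∈ Mgrp 𝔽 b := fun i j hij => hlM j i hij.symm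
    have hu' : u = transp y * transp l := by
      rw [← transp_mul, ← hyu, transp_transp]
    change f (ρ u v) = 0
    rw [hu', rep_mul_apply, ← dualRep_apply, hf y hy]
    exact h0 _ (apply_mem_leviSpan ρ v hlM')
  | zero => rw [map_zero, map_zero]
  | add x y _ _ hx hy => rw [map_add, hx, hy, map_add]
  | smul c x _ hx => rw [map_smul, hx, map_smul]

lemma finrank_fixed_dualRep_le {b : Fin n → ℕ} (hb : Monotone b) [FiniteDimensional C V]
    {ρ : Representation C (GL (Fin n) 𝔽) V} {v : V} (htop : lowerSpan ρ v = ⊤) :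
    Module.finrank C (fixedSub (dualRep ρ) (Nset 𝔽 b)) ≤ Module.finrank C (leviSpan b ρ v) := by
  rw [← Subspace.dual_finrank_eq (V := leviSpan b ρ v)]
  let L : fixedSub (dualRep ρ) (Nset 𝔽 b) →ₗ[C] Module.Dual C (leviSpan b ρ v) :=
    (leviSpan b ρ v).dualRestrict.comp (fixedSub (dualRep ρ) (Nset 𝔽 b)).subtype
  refine LinearMap.finrank_le_finrank_of_injective (f := L) ?_
  intro f g hfg
  refine Subtype.ext (sub_eq_zero.1 (eq_zero_of_leviSpan hb htop
    (Submodule.sub_mem _ f.2 g.2) fun x hx => ?_))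
  rw [LinearMap.sub_apply, sub_eq_zero]
  exact LinearMap.congr_fun hfg ⟨x, hx⟩

lemma finrank_fixed_le_dualRep_dualRep (b : Fin n → ℕ) [FiniteDimensional C V]
    (ρ : Representation C (GL (Fin n) 𝔽) V) :
    Module.finrank C (fixedSub ρ (Nset 𝔽 b))
      ≤ Module.finrank C (fixedSub (dualRep (dualRep ρ)) (Nset 𝔽 b)) := by
  have hmem : ∀ v ∈ fixedSub ρ (Nset 𝔽 b),
      Module.Dual.eval C V v ∈ fixedSub (dualRep (dualRep ρ)) (Nset 𝔽 b) := by
    intro v hv g hg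
    ext f
    change f (ρ g v) = f v
    rw [hv g hg]
  refine LinearMap.finrank_le_finrank_of_injective
    (f := (Module.Dual.eval C V).restrict hmem) ?_
  intro x y hxy
  refine Subtype.ext (Module.eval_apply_injective C (V := V) ?_)
  exact congrArg Subtype.val hxy

variable {p : ℕ} [Fact p.Prime] [CharP 𝔽 p] [CharP C p] [IsAlgClosed C]

/-- The space of `N`-fixed vectors is spanned by the Levi translates of the highest weight
vector. -/
lemma fixed_radical_eq_leviSpan (p : ℕ) [Fact p.Prime] [CharP 𝔽 p] [CharP C p]
    {b : Fin n → ℕ} (hb : Monotone b)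
    {ρ : Representation C (GL (Fin n) 𝔽) V} (hρ : IsIrredRep ρ) {v : V}
    (hv : v ∈ fixedSub ρ (Uset 𝔽 n)) (htop : lowerSpan ρ v = ⊤) :
    fixedSub ρ (Nset 𝔽 b) = leviSpan b ρ v := by
  have hfd := hρ.finiteDimensional
  symm
  refine Submodule.eq_of_le_of_finrank_le
    (leviSpan_le_fixed (fixed_unip_le_fixed_radical hb ρ hv)) ?_
  obtain ⟨f, -, hfU, -, hftop, -⟩ := hρ.dualRep.exists_lowerSpan_eq_top (p := p)
  have h1 := finrank_fixed_dualRep_le hb htop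
  have h2 := finrank_fixed_dualRep_le hb hftop
  have h3 := Submodule.finrank_mono
    (leviSpan_le_fixed (fixed_unip_le_fixed_radical hb _ hfU))
  exact (finrank_fixed_le_dualRep_dualRep b ρ).trans (h2.trans (h3.trans h1))

lemma leviSpan_val_le {ρ : Representation C (GL (Fin n) 𝔽) V} {v : V} (hT : IsTorusEigen ρ v) :
    leviSpan Fin.val ρ v ≤ Submodule.span C {v} := by
  refine Submodule.span_le.2 ?_
  rintro _ ⟨m, hm, rfl⟩
  obtain ⟨d, rfl⟩ := exists_eq_diagGL hm
  obtain ⟨c, hc⟩ := hT d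
  exact Submodule.mem_span_singleton.2 ⟨c, hc.symm⟩

lemma val_monotone : Monotone (Fin.val : Fin n → ℕ) := fun _ _ h => h

lemma fixed_unip_eq_span (p : ℕ) [Fact p.Prime] [CharP 𝔽 p] [CharP C p]
    {ρ : Representation C (GL (Fin n) 𝔽) V} (hρ : IsIrredRep ρ) {v : V}
    (hv : v ∈ fixedSub ρ (Uset 𝔽 n)) (hT : IsTorusEigen ρ v) (htop : lowerSpan ρ v = ⊤) :
    fixedSub ρ (Uset 𝔽 n) = Submodule.span C {v} := by
  refine le_antisymm ?_ (by rwa [Submodule.span_singleton_le_iff_mem])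
  have := fixed_radical_eq_leviSpan p val_monotone hρ hv htop
  rw [Nset_val] at this
  rw [this]
  exact leviSpan_val_le hT

/-- A nonzero `U`-fixed functional does not vanish at the highest weight vector. -/
lemma apply_ne_zero_of_fixed_dualRep {ρ : Representation C (GL (Fin n) 𝔽) V} {v : V}
    (hT : IsTorusEigen ρ v) (htop : lowerSpan ρ v = ⊤) {f : Module.Dual C V}
    (hf : f ∈ fixedSub (dualRep ρ) (Uset 𝔽 n)) (hf0 : f ≠ 0) : f v ≠ 0 := by
  intro h
  rw [← Nset_val] at hf
  refine hf0 (eq_zero_of_leviSpan val_monotone htop hf fun x hx => ?_)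
  obtain ⟨c, rfl⟩ := Submodule.mem_span_singleton.1 (leviSpan_val_le hT hx)
  rw [map_smul, h, smul_zero]

/-- Smith's theorem: the `N`-fixed vectors form an irreducible representation of the Levi. -/
lemma eq_bot_or_eq_fixed_radical (p : ℕ) [Fact p.Prime] [CharP 𝔽 p] [CharP C p]
    {b : Fin n → ℕ} (hb : Monotone b)
    {ρ : Representation C (GL (Fin n) 𝔽) V} (hρ : IsIrredRep ρ) {S : Submodule C V}
    (hS : S ≤ fixedSub ρ (Nset 𝔽 b)) (hM : ∀ m ∈ Mgrp 𝔽 b, ∀ v ∈ S, ρ m v ∈ S) :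
    S = ⊥ ∨ S = fixedSub ρ (Nset 𝔽 b) := by
  refine or_iff_not_imp_left.2 fun hbot => le_antisymm hS ?_
  obtain ⟨v, hv0, hv, hT, htop, -⟩ := hρ.exists_lowerSpan_eq_top (p := p)
  have hstab : ∀ g ∈ unip 𝔽 n, ∀ x ∈ S, ρ g x ∈ S := by
    intro g hg x hx
    obtain ⟨y, hy, hgy⟩ := exists_levi_mul_radical (unip_le_parabolic hb hg)
    rw [hgy, rep_mul_apply, mem_fixed_radical.1 (hS hx) y hy]
    exact hM _ (leviProj_mem b _) _ hx
  obtain ⟨x, hxS, hx0, hx⟩ := exists_fixed_of_isPGroup ρ (unip 𝔽 n) (isPGroup_unip p) S hbot hstab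
  have hxv : x ∈ Submodule.span C {v} := by
    rw [← fixed_unip_eq_span p hρ hv hT htop]
    exact mem_fixed_unip.2 hx
  obtain ⟨c, rfl⟩ := Submodule.mem_span_singleton.1 hxv
  have hc : c ≠ 0 := fun h => hx0 (by rw [h, zero_smul])
  have hvS : v ∈ S := by
    have := S.smul_mem c⁻¹ hxS
    rwa [inv_smul_smul₀ hc] at this
  rw [fixed_radical_eq_leviSpan p hb hρ hv htop]
  refine Submodule.span_le.2 ?_
  rintro _ ⟨m, hm, rfl⟩
  exact hM m hm v hvS

end

section

variable {𝔽 : Type} [Field 𝔽] [Fintype 𝔽] {n : ℕ} {C : Type} [Field C]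
  {V : Type} [AddCommGroup V] [Module C V]

/-- The stabilizer of the space of `U`-fixed vectors, as a subgroup. -/
def fixedStab (ρ : Representation C (GL (Fin n) 𝔽) V) : Subgroup (GL (Fin n) 𝔽) where
  carrier := PVset ρ
  one_mem' := by
    change Submodule.map (ρ 1) _ = _
    rw [map_one]; exact Submodule.map_id _
  mul_mem' {a b} ha hb := by
    change Submodule.map (ρ (a * b)) _ = _
    have ha' : Submodule.map (ρ a) _ = _ := ha
    have hb' : Submodule.map (ρ b) _ = _ := hb
    rw [map_mul, Module.End.mul_eq_comp, Submodule.map_comp, hb', ha']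
  inv_mem' {a} ha := by
    change Submodule.map (ρ a⁻¹) _ = _
    have ha' : Submodule.map (ρ a) _ = _ := ha
    conv_lhs => rw [← ha']
    rw [← Submodule.map_comp, ← Module.End.mul_eq_comp, ← map_mul, inv_mul_cancel, map_one]
    exact Submodule.map_id _

lemma mem_fixedStab {ρ : Representation C (GL (Fin n) 𝔽) V} {g : GL (Fin n) 𝔽} :
    g ∈ fixedStab ρ ↔ g ∈ PVset ρ := Iff.rfl

lemma apply_mem_of_mem_fixedStab {ρ : Representation C (GL (Fin n) 𝔽) V} {g : GL (Fin n) 𝔽}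
    (hg : g ∈ fixedStab ρ) {v : V} (hv : v ∈ fixedSub ρ (Uset 𝔽 n)) :
    ρ g v ∈ fixedSub ρ (Uset 𝔽 n) := by
  have h : Submodule.map (ρ g) _ = _ := hg
  rw [← h]
  exact Submodule.mem_map_of_mem hv

lemma le_fixedStab {ρ : Representation C (GL (Fin n) 𝔽) V} {H : Subgroup (GL (Fin n) 𝔽)}
    (h : ∀ g ∈ H, ∀ v ∈ fixedSub ρ (Uset 𝔽 n), ρ g v ∈ fixedSub ρ (Uset 𝔽 n)) :
    H ≤ fixedStab ρ := by
  intro g hg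
  change Submodule.map (ρ g) _ = _
  refine le_antisymm (Submodule.map_le_iff_le_comap.2 fun v hv => h g hg v hv) fun v hv => ?_
  refine ⟨ρ g⁻¹ v, h _ (inv_mem hg) v hv, ?_⟩
  rw [← rep_mul_apply, mul_inv_cancel, rep_one_apply]

lemma borel_le_fixedStab (ρ : Representation C (GL (Fin n) 𝔽) V) :
    parabolic 𝔽 (Fin.val : Fin n → ℕ) ≤ fixedStab ρ := by
  refine le_fixedStab fun g hg v hv => ?_
  rw [← Nset_val] at hv ⊢
  exact parabolic_apply_mem_fixed hv hg

lemma unip_le_borel : unip 𝔽 n ≤ parabolic 𝔽 (Fin.val : Fin n → ℕ) :=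
  unip_le_parabolic val_monotone

lemma diagGL_mem_borel (d : Fin n → 𝔽ˣ) :
    diagGL d ∈ parabolic 𝔽 (Fin.val : Fin n → ℕ) :=
  Mgrp_le_parabolic _ (diagGL_mem_Mgrp _ d)

lemma elem_mul_permGL (w : Equiv.Perm (Fin n)) {i j : Fin n} (h : i ≠ j) (x : 𝔽) :
    elem h x * permGL w
      = permGL w * elem ((w⁻¹ : Equiv.Perm (Fin n)).injective.ne h) x := by
  have := conj_elem (𝔽 := 𝔽) w⁻¹ h x
  rw [map_inv, inv_inv] at this
  rw [← this]; group

/-- The Bruhat decomposition. -/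
lemma exists_bruhat (g : GL (Fin n) 𝔽) :
    ∃ b₁ ∈ parabolic 𝔽 (Fin.val : Fin n → ℕ), ∃ b₂ ∈ parabolic 𝔽 (Fin.val : Fin n → ℕ),
      ∃ w : Equiv.Perm (Fin n), g = b₁ * permGL w * b₂ := by
  set B := parabolic 𝔽 (Fin.val : Fin n → ℕ) with hB
  let S : Set (GL (Fin n) 𝔽) := {g | ∃ b₁ ∈ B, ∃ b₂ ∈ B, ∃ w, g = b₁ * permGL w * b₂}
  have hBS : ∀ b ∈ B, ∀ g ∈ S, b * g ∈ S := by
    rintro b hb _ ⟨b₁, hb₁, b₂, hb₂, w, rfl⟩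
    exact ⟨b * b₁, mul_mem hb hb₁, b₂, hb₂, w, by simp only [mul_assoc]⟩
  let Q : Submonoid (GL (Fin n) 𝔽) :=
    { carrier := {g | ∀ x ∈ S, g * x ∈ S}
      one_mem' := fun x hx => by rwa [one_mul]
      mul_mem' := fun {a b} ha hb x hx => by rw [mul_assoc]; exact ha _ (hb _ hx) }
  suffices h : g ∈ Q by
    have := h 1 ⟨1, one_mem _, 1, one_mem _, 1, by simp⟩
    rwa [mul_one] at this
  refine mem_of_generators Q ?_ (fun d x hx => hBS _ (diagGL_mem_borel d) x hx)
    (fun i j h _ x y hy => hBS _ (unip_le_borel (elem_mem_unip h x)) y hy) g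
  rintro i j hij _ ⟨b₁, hb₁, b₂, hb₂, w, rfl⟩
  have h : i < j := by rw [Fin.lt_def]; omega
  have hss := permGL_swap_mul_self (𝔽 := 𝔽) i j
  obtain ⟨u, hu, hbu⟩ := exists_levi_mul_radical hb₁
  obtain ⟨d, hd⟩ := exists_eq_diagGL (leviProj_mem Fin.val ⟨b₁, hb₁⟩)
  rw [hd] at hbu
  set x := u.1 i j with hx
  have hu' := mem_unip.1 hu
  set m := u * elem h.ne (-x) with hm
  have hmu : m ∈ unip 𝔽 n := mul_mem hu (elem_mem_unip h _)
  have hm0 : m.1 i j = 0 := by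
    rw [hm, mul_elem_apply, if_pos rfl, hu'.2 i, one_mul, ← hx, add_neg_cancel]
  have hum : u = m * elem h.ne x := by
    rw [hm, mul_assoc, elem_mul_elem, neg_add_cancel, elem_zero, mul_one]
  have key : permGL (Equiv.swap i j) * (b₁ * permGL w * b₂)
      = (permGL (Equiv.swap i j) * diagGL d * permGL (Equiv.swap i j))
        * ((permGL (Equiv.swap i j) * m * permGL (Equiv.swap i j))
        * (permGL (Equiv.swap i j) * (elem h.ne x * permGL w) * b₂)) := by
    rw [hbu, hum]
    simp only [mul_assoc]
    rw [← mul_assoc (permGL (Equiv.swap i j)) (permGL (Equiv.swap i j)), hss, one_mul,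
      ← mul_assoc (permGL (Equiv.swap i j)) (permGL (Equiv.swap i j)), hss, one_mul]
  rw [key, swap_mul_diagGL_mul_swap]
  refine hBS _ (diagGL_mem_borel _) _ (hBS _ (unip_le_borel (swap_conj_mem_unip hij hmu hm0)) _ ?_)
  rcases lt_or_gt_of_ne ((w⁻¹ : Equiv.Perm (Fin n)).injective.ne h.ne) with hlt | hgt
  · refine ⟨1, one_mem _, _, mul_mem (unip_le_borel (elem_mem_unip hlt x)) hb₂,
      Equiv.swap i j * w, ?_⟩
    rw [elem_mul_permGL, map_mul, one_mul]
    simp only [mul_assoc]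
  · by_cases hx0 : x = 0
    · refine ⟨1, one_mem _, b₂, hb₂, Equiv.swap i j * w, ?_⟩
      rw [hx0, elem_zero, one_mul, map_mul, one_mul]
    · set z := Units.mk0 x hx0
      have hz : x = (z : 𝔽) := rfl
      have h1 : permGL (Equiv.swap i j) * elem h.ne x
          = elem h.ne ((z⁻¹ : 𝔽ˣ) : 𝔽) * corootGL i j z * elem h.ne' ((z⁻¹ : 𝔽ˣ) : 𝔽) := by
        have e1 := swap_conj_elem h.ne x
        have e2 := swap_conj_elem h.ne ((z⁻¹ : 𝔽ˣ) : 𝔽)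
        rw [← e2]
        have e3 := elem_eq_bigCell h.ne z
        rw [← hz, ← e1] at e3
        have e4 := congrArg (· * permGL (Equiv.swap i j)) e3
        simp only [mul_assoc, hss, mul_one] at e4
        simp only [mul_assoc]
        exact e4
      refine ⟨elem h.ne ((z⁻¹ : 𝔽ˣ) : 𝔽) * corootGL i j z,
        mul_mem (unip_le_borel (elem_mem_unip h _)) (diagGL_mem_borel _), _,
        mul_mem (unip_le_borel (elem_mem_unip hgt ((z⁻¹ : 𝔽ˣ) : 𝔽))) hb₂, w, ?_⟩
      rw [← mul_assoc (permGL (Equiv.swap i j)), h1, mul_assoc _ _ (permGL w), elem_mul_permGL]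
      simp only [mul_assoc]

/-- A subgroup containing the Borel subgroup is contained in a standard parabolic as soon as its
simple reflections are. -/
lemma le_parabolic_of_simple {b : Fin n → ℕ} {K : Subgroup (GL (Fin n) 𝔽)}
    (hK : parabolic 𝔽 (Fin.val : Fin n → ℕ) ≤ K) (hb : Monotone b)
    (hs : ∀ i j : Fin n, (i : ℕ) + 1 = j → permGL (Equiv.swap i j) ∈ K → b i = b j) :
    K ≤ parabolic 𝔽 b := by
  have hBP : parabolic 𝔽 (Fin.val : Fin n → ℕ) ≤ parabolic 𝔽 b :=
    fun g hg i j hij => hg i j (hb.reflect_lt hij)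
  have hw : ∀ w : Equiv.Perm (Fin n), permGL w ∈ K → permGL w ∈ parabolic 𝔽 b := by
    intro w
    induction w using perm_ascent_induction with
    | one => intro _; rw [map_one]; exact one_mem _
    | step w i j hij hw ih =>
      intro hK'
      have h : i < j := by rw [Fin.lt_def]; omega
      have hne := (Equiv.swap i j * w).injective.ne hw.ne
      have h1 := mul_mem (mul_mem hK' (hK (unip_le_borel (elem_mem_unip hw (1 : 𝔽))))) (inv_mem hK')
      rw [conj_elem] at h1
      have h2 : elem h.ne' (1 : 𝔽) ∈ K := by
        convert h1 <;> simp [Equiv.Perm.mul_apply]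
      have h3 := elem_eq_bigCell h.ne (1 : 𝔽ˣ)
      rw [inv_one, Units.val_one] at h3
      have hx : elem h.ne (1 : 𝔽) ∈ K := hK (unip_le_borel (elem_mem_unip h 1))
      have ht : corootGL i j (1 : 𝔽ˣ) ∈ K := hK (diagGL_mem_borel _)
      have hsK : permGL (Equiv.swap i j) ∈ K := by
        rw [h3] at h2
        exact (K.mul_mem_cancel_left (mul_mem hx ht)).1 ((K.mul_mem_cancel_right hx).1 h2)
      rw [map_mul] at hK' ⊢
      exact mul_mem (Mgrp_le_parabolic b (swap_mem_Mgrp (hs i j hij hsK)))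
        (ih ((K.mul_mem_cancel_left hsK).1 hK'))
  intro g hg
  obtain ⟨b₁, hb₁, b₂, hb₂, w, rfl⟩ := exists_bruhat g
  have hwK := (K.mul_mem_cancel_left (hK hb₁)).1 ((K.mul_mem_cancel_right (hK hb₂)).1 hg)
  exact mul_mem (mul_mem (hBP hb₁) (hw w hwK)) (hBP hb₂)

lemma eq_of_swap_mem_parabolic {b : Fin n → ℕ} (hb : Monotone b) {i j : Fin n} (h : i < j)
    (hs : permGL (Equiv.swap i j) ∈ parabolic 𝔽 b) : b i = b j := by
  refine (hb h.le).antisymm (not_lt.1 fun hlt => ?_)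
  have := hs j i hlt
  change (permGL (Equiv.swap i j)).1 j i = 0 at this
  rw [permGL_apply, Equiv.swap_apply_left, if_pos rfl] at this
  exact one_ne_zero this

lemma PVset_eq_Pset_iff (p : ℕ) [Fact p.Prime] [CharP 𝔽 p] [CharP C p] [IsAlgClosed C]
    {b : Fin n → ℕ} (hb : Monotone b) {ρ : Representation C (GL (Fin n) 𝔽) V}
    (hρ : IsIrredRep ρ) (hreg : PVset ρ ⊆ Pset 𝔽 b) :
    PVset ρ = Pset 𝔽 b ↔ Module.finrank C (fixedSub ρ (Nset 𝔽 b)) = 1 := by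
  have hfd := hρ.finiteDimensional
  obtain ⟨v, hv0, hv, hT, htop, -⟩ := hρ.exists_lowerSpan_eq_top (p := p)
  have hspan := fixed_unip_eq_span p hρ hv hT htop
  have hle := fixed_unip_le_fixed_radical hb ρ
  have h1 : Module.finrank C (fixedSub ρ (Uset 𝔽 n)) = 1 := by
    rw [hspan]; exact finrank_span_singleton hv0
  constructor
  · intro h
    rcases eq_bot_or_eq_fixed_radical p hb hρ hle (fun m hm x hx => by
      refine apply_mem_of_mem_fixedStab ?_ hx
      rw [mem_fixedStab, h]
      exact Mgrp_le_parabolic b hm) with hbot | heq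
    · rw [hbot, Submodule.mem_bot] at hv
      exact absurd hv hv0
    · rw [← heq, h1]
  · intro h
    have heq := Submodule.eq_of_le_of_finrank_eq hle (h1.trans h.symm)
    refine hreg.antisymm ?_
    have : parabolic 𝔽 b ≤ fixedStab ρ := le_fixedStab fun g hg x hx => by
      rw [heq] at hx ⊢
      exact parabolic_apply_mem_fixed hx hg
    exact this

end

section

variable {𝔽 : Type} [Field 𝔽] [Fintype 𝔽] {n : ℕ} {C : Type} [Field C]
  {V : Type} [AddCommGroup V] [Module C V]

/-- If the simple reflection does not stabilize the `U`-fixed line, the Hecke eigenvalue is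
determined by the torus character. -/
lemma heckeOp_of_swap_notMem (hchar : (Fintype.card 𝔽 : C) = 0)
    {ρ : Representation C (GL (Fin n) 𝔽) V} {v : V} (hv0 : v ≠ 0)
    (hspan : fixedSub ρ (Uset 𝔽 n) = Submodule.span C {v}) (hT : IsTorusEigen ρ v)
    {i j : Fin n} (h : i < j) (hH : ∃ c : C, heckeOp ρ h.ne v = c • v)
    (hs : permGL (Equiv.swap i j) ∉ PVset ρ) :
    heckeOp ρ h.ne v = ∑ z : 𝔽ˣ, ρ (corootGL i j z) v := by
  have hv : v ∈ fixedSub ρ (Uset 𝔽 n) := hspan ▸ Submodule.mem_span_singleton_self v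
  have hfix : ∀ x, ρ (elem h.ne x) v = v := fun x => mem_fixed_unip.1 hv _ (elem_mem_unip h x)
  obtain ⟨c, hc⟩ := hH
  obtain ⟨l, hl⟩ := hT.exists_sum_coroot i j
  have hsq := heckeOp_sq hchar ρ h.ne hfix
  simp only [hc, map_smul] at hsq
  rw [← Finset.smul_sum, hl] at hsq
  by_cases hc0 : c ≠ 0
  · rw [hc, hl]
    exact (smul_right_injective V hc0) hsq
  rw [not_not] at hc0
  subst hc0
  rw [hc, zero_smul, hl]
  by_contra hne
  have hl0 : l ≠ 0 := fun h0 => hne (by rw [h0, zero_smul])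
  have hχ : ∀ z : 𝔽ˣ, ∃ c : C, ρ (corootGL i j z) v = c • v := fun z => hT _
  choose χ hχ using hχ
  have hlsum : ∑ z, χ z = l := by
    have h1 : (∑ z, χ z) • v = l • v := by
      rw [Finset.sum_smul, ← hl]
      exact Finset.sum_congr rfl fun z _ => (hχ z).symm
    exact smul_left_injective C hv0 h1
  have hmul : ∀ x y, χ (x * y) * χ 1 = χ x * χ y := by
    intro x y
    have h1 := congrArg (fun g => ρ g v) (corootGL_mul i j x y)
    simp only [rep_mul_apply, hχ, map_smul, smul_smul] at h1
    have h2 := smul_left_injective C hv0 h1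
    rw [mul_comm, h2, mul_comm]
  have hconst : ∀ x, χ x = χ 1 := by
    intro x
    have h1 : (∑ y, χ (x * y)) * χ 1 = χ x * ∑ y, χ y := by
      rw [Finset.sum_mul, Finset.mul_sum]
      exact Finset.sum_congr rfl fun y _ => hmul x y
    rw [Fintype.sum_equiv (Equiv.mulLeft x) (fun y => χ (x * y)) χ fun _ => rfl, hlsum,
      mul_comm] at h1
    exact (mul_right_cancel₀ hl0 h1).symm
  have hε0 : χ 1 ≠ 0 := fun h0 => hl0 (by
    rw [← hlsum]; exact Finset.sum_eq_zero fun z _ => by rw [hconst, h0])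
  rw [zero_smul] at hc
  have h1 := congrArg (ρ (permGL (Equiv.swap i j))) hc
  rw [heckeOp_apply, map_sum, map_zero] at h1
  have h2 : ∀ x : 𝔽, ρ (permGL (Equiv.swap i j)) (ρ (elem h.ne x * permGL (Equiv.swap i j)) v)
      = ρ (elem h.ne' x) v := by
    intro x
    rw [← rep_mul_apply, ← mul_assoc, swap_conj_elem]
  simp only [h2] at h1
  rw [sum_eq_zero_add_units, elem_zero, rep_one_apply] at h1
  rw [heckeOp_eq_swap_add ρ h.ne hfix] at hc
  simp only [corootGL_swap h.ne, hχ, hconst, map_smul] at hc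
  rw [← Finset.smul_sum, Fintype.sum_equiv (Equiv.inv 𝔽ˣ)
    (fun z : 𝔽ˣ => ρ (elem h.ne' ((z⁻¹ : 𝔽ˣ) : 𝔽)) v) (fun z : 𝔽ˣ => ρ (elem h.ne' (z : 𝔽)) v) fun _ => rfl] at hc
  rw [eq_neg_of_add_eq_zero_right h1, smul_neg, ← sub_eq_add_neg, sub_eq_zero] at hc
  refine hs ?_
  change Submodule.map (ρ _) _ = _
  rw [hspan, Submodule.map_span, Set.image_singleton, hc]
  exact Submodule.span_singleton_smul_eq (IsUnit.mk0 _ hε0) v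

variable {Γ : Type} [Group Γ] {V₁ V₂ : Type} [AddCommGroup V₁] [Module C V₁]
  [AddCommGroup V₂] [Module C V₂]

/-- The direct sum of two representations. -/
def prodRep (ρ₁ : Representation C Γ V₁) (ρ₂ : Representation C Γ V₂) :
    Representation C Γ (V₁ × V₂) where
  toFun g := (ρ₁ g).prodMap (ρ₂ g)
  map_one' := by rw [map_one, map_one]; rfl
  map_mul' g h := by rw [map_mul, map_mul]; rfl

lemma prodRep_apply (ρ₁ : Representation C Γ V₁) (ρ₂ : Representation C Γ V₂) (g : Γ)
    (x : V₁ × V₂) : prodRep ρ₁ ρ₂ g x = (ρ₁ g x.1, ρ₂ g x.2) := rfl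

/-- A subrepresentation of a direct sum of two irreducible representations which projects
nontrivially on both factors and contains neither of them is the graph of an isomorphism. -/
lemma exists_equiv_of_stable {ρ₁ : Representation C Γ V₁} {ρ₂ : Representation C Γ V₂}
    (h₁ : IsIrredRep ρ₁) (h₂ : IsIrredRep ρ₂) {X : Submodule C (V₁ × V₂)}
    (hX : ∀ g, ∀ x ∈ X, prodRep ρ₁ ρ₂ g x ∈ X)
    {x : V₁ × V₂} (hx : x ∈ X) (hx₁ : x.1 ≠ 0) (hx₂ : x.2 ≠ 0)
    {y₁ : V₁} (hy₁ : (y₁, (0 : V₂)) ∉ X) {y₂ : V₂} (hy₂ : ((0 : V₁), y₂) ∉ X) :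
    ∃ E : V₁ ≃ₗ[C] V₂, ∀ g v, E (ρ₁ g v) = ρ₂ g (E v) := by
  have hinj₁ : Function.Injective ((LinearMap.fst C V₁ V₂).comp X.subtype) := by
    have hS := h₂.2 (X.comap (LinearMap.inr C V₁ V₂)) fun g v hv => by
      have := hX g _ hv
      rw [prodRep_apply] at this
      simpa using this
    have hS' : X.comap (LinearMap.inr C V₁ V₂) = ⊥ := hS.resolve_right fun h =>
      hy₂ (show y₂ ∈ X.comap (LinearMap.inr C V₁ V₂) from h ▸ Submodule.mem_top)
    intro a b hab
    have hab' : a.1.1 = b.1.1 := hab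
    have : (a - b : V₁ × V₂).2 ∈ X.comap (LinearMap.inr C V₁ V₂) := by
      have h3 := (a - b).2
      rw [Submodule.mem_comap]
      convert h3 using 1
      ext <;> simp [hab']
    rw [hS', Submodule.mem_bot] at this
    exact Subtype.ext (Prod.ext hab' (sub_eq_zero.1 this))
  have hinj₂ : Function.Injective ((LinearMap.snd C V₁ V₂).comp X.subtype) := by
    have hS := h₁.2 (X.comap (LinearMap.inl C V₁ V₂)) fun g v hv => by
      have := hX g _ hv
      rw [prodRep_apply] at this
      simpa using this
    have hS' : X.comap (LinearMap.inl C V₁ V₂) = ⊥ := hS.resolve_right fun h =>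
      hy₁ (show y₁ ∈ X.comap (LinearMap.inl C V₁ V₂) from h ▸ Submodule.mem_top)
    intro a b hab
    have hab' : a.1.2 = b.1.2 := hab
    have : (a - b : V₁ × V₂).1 ∈ X.comap (LinearMap.inl C V₁ V₂) := by
      have h3 := (a - b).2
      rw [Submodule.mem_comap]
      convert h3 using 1
      ext <;> simp [hab']
    rw [hS', Submodule.mem_bot] at this
    exact Subtype.ext (Prod.ext (sub_eq_zero.1 this) hab')
  have hsurj₁ : Function.Surjective ((LinearMap.fst C V₁ V₂).comp X.subtype) := by
    rw [← LinearMap.range_eq_top]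
    refine (h₁.2 _ ?_).resolve_left fun h => hx₁ ?_
    · rintro g _ ⟨a, rfl⟩
      exact ⟨⟨_, hX g _ a.2⟩, rfl⟩
    · rw [← Submodule.mem_bot C, ← h]
      exact ⟨⟨x, hx⟩, rfl⟩
  have hsurj₂ : Function.Surjective ((LinearMap.snd C V₁ V₂).comp X.subtype) := by
    rw [← LinearMap.range_eq_top]
    refine (h₂.2 _ ?_).resolve_left fun h => hx₂ ?_
    · rintro g _ ⟨a, rfl⟩
      exact ⟨⟨_, hX g _ a.2⟩, rfl⟩
    · rw [← Submodule.mem_bot C, ← h]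
      exact ⟨⟨x, hx⟩, rfl⟩
  let e₁ := LinearEquiv.ofBijective _ ⟨hinj₁, hsurj₁⟩
  let e₂ := LinearEquiv.ofBijective _ ⟨hinj₂, hsurj₂⟩
  refine ⟨e₁.symm.trans e₂, fun g v => ?_⟩
  obtain ⟨a, rfl⟩ := e₁.surjective v
  have : ρ₁ g (e₁ a) = e₁ ⟨_, hX g _ a.2⟩ := rfl
  rw [this, LinearEquiv.trans_apply, LinearEquiv.trans_apply, LinearEquiv.symm_apply_apply,
    LinearEquiv.symm_apply_apply]
  rfl

/-- Two irreducible representations whose highest weight vectors have equal eigenvalues are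
isomorphic. -/
lemma exists_equiv_of_weight (p : ℕ) [Fact p.Prime] [CharP 𝔽 p] [CharP C p] [IsAlgClosed C]
    {ρ₁ : Representation C (GL (Fin n) 𝔽) V₁} {ρ₂ : Representation C (GL (Fin n) 𝔽) V₂}
    (h₁ : IsIrredRep ρ₁) (h₂ : IsIrredRep ρ₂) {v₁ : V₁} {v₂ : V₂} (hv₁0 : v₁ ≠ 0) (hv₂0 : v₂ ≠ 0)
    (hv₁ : v₁ ∈ fixedSub ρ₁ (Uset 𝔽 n)) (hv₂ : v₂ ∈ fixedSub ρ₂ (Uset 𝔽 n))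
    (hT : ∀ d, ∃ c : C, ρ₁ (diagGL d) v₁ = c • v₁ ∧ ρ₂ (diagGL d) v₂ = c • v₂)
    (hH : ∀ (i j : Fin n) (h : i < j), (i : ℕ) + 1 = j →
      ∃ c : C, heckeOp ρ₁ h.ne v₁ = c • v₁ ∧ heckeOp ρ₂ h.ne v₂ = c • v₂) :
    ∃ E : V₁ ≃ₗ[C] V₂, ∀ g v, E (ρ₁ g v) = ρ₂ g (E v) := by
  have htop₁ : lowerSpan ρ₁ v₁ = ⊤ :=
    (h₁.2 _ (lowerSpan_stable hv₁ (fun d => (hT d).imp fun _ h => h.1)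
      fun i j h hij => (hH i j h hij).imp fun _ h => h.1)).resolve_left fun h => hv₁0 (by
        rw [← Submodule.mem_bot C, ← h]; exact self_mem_lowerSpan ρ₁ v₁)
  have htop₂ : lowerSpan ρ₂ v₂ = ⊤ :=
    (h₂.2 _ (lowerSpan_stable hv₂ (fun d => (hT d).imp fun _ h => h.2)
      fun i j h hij => (hH i j h hij).imp fun _ h => h.2)).resolve_left fun h => hv₂0 (by
        rw [← Submodule.mem_bot C, ← h]; exact self_mem_lowerSpan ρ₂ v₂)
  have hX := lowerSpan_stable (ρ := prodRep ρ₁ ρ₂) (v := (v₁, v₂))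
    (fun g hg => by rw [prodRep_apply, hv₁ g hg, hv₂ g hg])
    (fun d => (hT d).imp fun c h => by rw [prodRep_apply, h.1, h.2]; rfl)
    (fun i j h hij => (hH i j h hij).imp fun c h => by
      rw [Prod.smul_mk, ← h.1, ← h.2]
      simp only [heckeOp_apply, prodRep_apply]
      ext <;> simp [Prod.fst_sum, Prod.snd_sum])
  obtain ⟨f₁, hf₁0, hf₁, -⟩ := h₁.dualRep.exists_lowerSpan_eq_top (p := p)
  obtain ⟨f₂, hf₂0, hf₂, -⟩ := h₂.dualRep.exists_lowerSpan_eq_top (p := p)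
  have h1 := apply_ne_zero_of_fixed_dualRep (fun d => (hT d).imp fun _ h => h.1) htop₁ hf₁ hf₁0
  have h2 := apply_ne_zero_of_fixed_dualRep (fun d => (hT d).imp fun _ h => h.2) htop₂ hf₂ hf₂0
  have hF : ∀ x ∈ lowerSpan (prodRep ρ₁ ρ₂) (v₁, v₂), f₁ x.1 * f₂ v₂ = f₂ x.2 * f₁ v₁ := by
    intro x hx
    induction hx using Submodule.span_induction with
    | mem x hx =>
      obtain ⟨u, hu, rfl⟩ := hx
      have e₁ := LinearMap.congr_fun (mem_fixed_unip.1 hf₁ _ (mem_lowerUnip.1 hu)) v₁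
      have e₂ := LinearMap.congr_fun (mem_fixed_unip.1 hf₂ _ (mem_lowerUnip.1 hu)) v₂
      rw [dualRep_apply, transp_transp] at e₁ e₂
      simp only [prodRep_apply, e₁, e₂, mul_comm]
    | zero => simp
    | add x y _ _ hx hy => simp [add_mul, hx, hy]
    | smul c x _ hx => simp [mul_assoc, hx]
  refine exists_equiv_of_stable h₁ h₂ hX (self_mem_lowerSpan _ _) hv₁0 hv₂0 (y₁ := v₁) (y₂ := v₂)
    (fun h => ?_) (fun h => ?_)
  · have := hF _ h
    simp only [map_zero, zero_mul] at this
    exact mul_ne_zero h1 h2 this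
  · have := hF _ h
    simp only [map_zero, zero_mul] at this
    exact mul_ne_zero h2 h1 this.symm

end

section

variable {𝔽 : Type} [Field 𝔽] [Fintype 𝔽] {n : ℕ} {C : Type} [Field C]
  {V₁ V₂ : Type} [AddCommGroup V₁] [Module C V₁] [AddCommGroup V₂] [Module C V₂]

/-- A Levi equivariant map between the fixed vectors transports eigenvalue equations for sums
of elements of the Levi subgroup. -/
lemma transport_sum {b : Fin n → ℕ}
    {ρ₁ : Representation C (GL (Fin n) 𝔽) V₁} {ρ₂ : Representation C (GL (Fin n) 𝔽) V₂}
    (e : fixedSub ρ₁ (Nset 𝔽 b) ≃ₗ[C] fixedSub ρ₂ (Nset 𝔽 b))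
    (he : ∀ (m : Mgrp 𝔽 b) (v w : fixedSub ρ₁ (Nset 𝔽 b)),
      (w : V₁) = ρ₁ m v → (e w : V₂) = ρ₂ m (e v))
    {ι : Type} [Fintype ι] (m : ι → GL (Fin n) 𝔽) (hm : ∀ k, m k ∈ Mgrp 𝔽 b)
    (v : fixedSub ρ₁ (Nset 𝔽 b)) {c : C} (h : ∑ k, ρ₁ (m k) (v : V₁) = c • (v : V₁)) :
    ∑ k, ρ₂ (m k) (e v : V₂) = c • (e v : V₂) := by
  have h1 : ∑ k, (⟨ρ₁ (m k) v, parabolic_apply_mem_fixed v.2 (Mgrp_le_parabolic b (hm k))⟩ :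
      fixedSub ρ₁ (Nset 𝔽 b)) = c • v := by
    ext
    simpa using h
  have h2 := congrArg (fun x => ((e x : fixedSub ρ₂ (Nset 𝔽 b)) : V₂)) h1
  simp only [map_sum, map_smul, Submodule.coe_sum, Submodule.coe_smul] at h2
  rw [← h2]
  exact Finset.sum_congr rfl fun k _ => (he ⟨m k, hm k⟩ v _ rfl).symm

lemma transport_mem_fixed_unip {b : Fin n → ℕ} (hb : Monotone b)
    {ρ₁ : Representation C (GL (Fin n) 𝔽) V₁} {ρ₂ : Representation C (GL (Fin n) 𝔽) V₂}
    (e : fixedSub ρ₁ (Nset 𝔽 b) ≃ₗ[C] fixedSub ρ₂ (Nset 𝔽 b))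
    (he : ∀ (m : Mgrp 𝔽 b) (v w : fixedSub ρ₁ (Nset 𝔽 b)),
      (w : V₁) = ρ₁ m v → (e w : V₂) = ρ₂ m (e v))
    (v : fixedSub ρ₁ (Nset 𝔽 b)) (hv : (v : V₁) ∈ fixedSub ρ₁ (Uset 𝔽 n)) :
    (e v : V₂) ∈ fixedSub ρ₂ (Uset 𝔽 n) := by
  rw [mem_fixed_unip]
  intro g hg
  have hgP := unip_le_parabolic hb hg
  obtain ⟨x, hx, hgx⟩ := exists_levi_mul_radical hgP
  have h1 := he ⟨_, leviProj_mem b ⟨g, hgP⟩⟩ v v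
    (mem_fixed_unip.1 hv _ (leviProj_mem_unip hgP hg)).symm
  rw [hgx, rep_mul_apply, mem_fixed_radical.1 (e v).2 x hx]
  exact h1.symm

/-- A nonzero vector of the `U`-fixed line of an irreducible representation has the properties of
a highest weight vector. -/
lemma fixed_unip_vector (p : ℕ) [Fact p.Prime] [CharP 𝔽 p] [CharP C p] [IsAlgClosed C]
    {V : Type} [AddCommGroup V] [Module C V]
    {ρ : Representation C (GL (Fin n) 𝔽) V} (hρ : IsIrredRep ρ) {v : V}
    (hv : v ∈ fixedSub ρ (Uset 𝔽 n)) (hv0 : v ≠ 0) :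
    fixedSub ρ (Uset 𝔽 n) = Submodule.span C {v} ∧ IsTorusEigen ρ v ∧
      ∀ (i j : Fin n) (h : i < j), (i : ℕ) + 1 = j → ∃ c : C, heckeOp ρ h.ne v = c • v := by
  obtain ⟨w, hw0, hw, hT, htop, hH⟩ := hρ.exists_lowerSpan_eq_top (p := p)
  have hspan := fixed_unip_eq_span p hρ hw hT htop
  obtain ⟨a, rfl⟩ := Submodule.mem_span_singleton.1 (hspan ▸ hv)
  have ha : a ≠ 0 := by rintro rfl; exact hv0 (zero_smul _ _)
  refine ⟨?_, fun d => ?_, fun i j h hij => ?_⟩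
  · rw [hspan, Submodule.span_singleton_smul_eq (IsUnit.mk0 a ha)]
  · obtain ⟨c, hc⟩ := hT d
    exact ⟨c, by rw [map_smul, hc, smul_comm]⟩
  · obtain ⟨c, hc⟩ := hH i j h hij
    exact ⟨c, by rw [map_smul, hc, smul_comm]⟩

lemma card_cast_eq_zero (p : ℕ) [CharP 𝔽 p] [CharP C p] : (Fintype.card 𝔽 : C) = 0 := by
  rw [CharP.cast_eq_zero_iff C p, ← CharP.cast_eq_zero_iff 𝔽 p]
  exact FiniteField.cast_card_eq_zero 𝔽

lemma exists_equiv_of_fixed_radical_equiv (p : ℕ) [Fact p.Prime] [CharP 𝔽 p] [CharP C p]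
    [IsAlgClosed C] {b : Fin n → ℕ} (hb : Monotone b)
    {ρ₁ : Representation C (GL (Fin n) 𝔽) V₁} {ρ₂ : Representation C (GL (Fin n) 𝔽) V₂}
    (h₁ : IsIrredRep ρ₁) (h₂ : IsIrredRep ρ₂)
    (hr₁ : PVset ρ₁ ⊆ Pset 𝔽 b) (hr₂ : PVset ρ₂ ⊆ Pset 𝔽 b)
    (e : fixedSub ρ₁ (Nset 𝔽 b) ≃ₗ[C] fixedSub ρ₂ (Nset 𝔽 b))
    (he : ∀ (m : Mgrp 𝔽 b) (v w : fixedSub ρ₁ (Nset 𝔽 b)),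
      (w : V₁) = ρ₁ m v → (e w : V₂) = ρ₂ m (e v)) :
    ∃ E : V₁ ≃ₗ[C] V₂, ∀ g v, E (ρ₁ g v) = ρ₂ g (E v) := by
  have hchar := card_cast_eq_zero (𝔽 := 𝔽) (C := C) p
  obtain ⟨v₁, hv₁0, hv₁, -⟩ := h₁.exists_lowerSpan_eq_top (p := p)
  obtain ⟨hspan₁, hT₁, hH₁⟩ := fixed_unip_vector p h₁ hv₁ hv₁0
  let v : fixedSub ρ₁ (Nset 𝔽 b) := ⟨v₁, fixed_unip_le_fixed_radical hb ρ₁ hv₁⟩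
  have hv₂ : (e v : V₂) ∈ fixedSub ρ₂ (Uset 𝔽 n) := transport_mem_fixed_unip hb e he v hv₁
  have hv₂0 : (e v : V₂) ≠ 0 := fun h0 => hv₁0 <| by
    have h1 : e v = 0 := Subtype.ext h0
    exact congrArg Subtype.val ((map_eq_zero_iff e e.injective).1 h1)
  obtain ⟨hspan₂, hT₂, hH₂⟩ := fixed_unip_vector p h₂ hv₂ hv₂0
  refine exists_equiv_of_weight p h₁ h₂ hv₁0 hv₂0 hv₁ hv₂ (fun d => ?_) fun i j h hij => ?_
  · obtain ⟨c, hc⟩ := hT₁ d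
    have h3 := transport_sum e he (fun _ : Unit => diagGL d) (fun _ => diagGL_mem_Mgrp b d) v
      (c := c) (by simpa using hc)
    exact ⟨c, hc, by simpa using h3⟩
  · by_cases hbij : b i = b j
    · obtain ⟨c, hc⟩ := hH₁ i j h hij
      have h3 := transport_sum e he (fun x : 𝔽 => elem h.ne x * permGL (Equiv.swap i j))
        (fun x => mul_mem (elem_mem_Mgrp h.ne hbij x) (swap_mem_Mgrp hbij)) v
        (c := c) (by rw [← heckeOp_apply]; exact hc)
      exact ⟨c, hc, by rw [heckeOp_apply]; exact h3⟩
    · have hs : permGL (Equiv.swap i j) ∉ Pset 𝔽 b := fun hs =>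
        hbij (eq_of_swap_mem_parabolic hb h hs)
      have e₁ := heckeOp_of_swap_notMem hchar hv₁0 hspan₁ hT₁ h (hH₁ i j h hij)
        fun h4 => hs (hr₁ h4)
      have e₂ := heckeOp_of_swap_notMem hchar hv₂0 hspan₂ hT₂ h (hH₂ i j h hij)
        fun h4 => hs (hr₂ h4)
      obtain ⟨c, hc⟩ := hT₁.exists_sum_coroot i j
      exact ⟨c, e₁.trans hc, e₂.trans
        (transport_sum e he (corootGL i j) (fun z => diagGL_mem_Mgrp b _) v hc)⟩

end

section

variable {𝔽 : Type} [Field 𝔽] [Fintype 𝔽] {n : ℕ} {C : Type} [Field C]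

/-- Every generated subrepresentation has an irreducible quotient. The equivariant map is
extended linearly to the whole space. -/
lemma exists_irred_quotient {Γ V : Type} [Group Γ] [AddCommGroup V] [Module C V]
    [FiniteDimensional C V] (ρ : Representation C Γ V) {S : Set V} {s₀ : V} (hs₀ : s₀ ∈ S)
    (hs₀0 : s₀ ≠ 0) :
    ∃ (V' : Type) (_ : AddCommGroup V') (_ : Module C V') (ρ' : Representation C Γ V'),
      IsIrredRep ρ' ∧ ∃ φ : V →ₗ[C] V', (∀ s ∈ S, ∀ g, φ (ρ g s) = ρ' g (φ s)) ∧
        ∃ s ∈ S, φ s ≠ 0 := by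
  let X : Submodule C V := Submodule.span C {x | ∃ s ∈ S, ∃ g, x = ρ g s}
  have hXS : ∀ s ∈ S, ∀ g, ρ g s ∈ X := fun s hs g => Submodule.subset_span ⟨s, hs, g, rfl⟩
  have hSX : ∀ s ∈ S, s ∈ X := fun s hs => by simpa using hXS s hs 1
  have hX : ∀ g, X ≤ X.comap (ρ g) := by
    intro g
    refine Submodule.span_le.2 ?_
    rintro _ ⟨s, hs, h, rfl⟩
    rw [SetLike.mem_coe, Submodule.mem_comap, ← rep_mul_apply]
    exact hXS s hs _
  let P : Submodule C V → Prop := fun Y => Y < X ∧ ∀ g, Y ≤ Y.comap (ρ g)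
  have hbot : P ⊥ := ⟨bot_lt_iff_ne_bot.2 fun h => hs₀0 (by
    rw [← Submodule.mem_bot C, ← h]; exact hSX _ hs₀), fun g => bot_le⟩
  obtain ⟨Y, ⟨hYX, hYst⟩, hmax⟩ :=
    (wellFounded_gt (α := Submodule C V)).has_min {Y | P Y} ⟨⊥, hbot⟩
  let V' : Submodule C (V ⧸ Y) := X.map Y.mkQ
  have hV' : ∀ g, ∀ v ∈ V', Y.mapQ Y (ρ g) (hYst g) v ∈ V' := by
    rintro g _ ⟨x, hx, rfl⟩
    exact ⟨ρ g x, hX g hx, rfl⟩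
  let ρ' : Representation C Γ V' :=
    { toFun := fun g => (Y.mapQ Y (ρ g) (hYst g)).restrict (hV' g)
      map_one' := by
        ext ⟨_, x, hx, rfl⟩
        change Y.mkQ (ρ 1 x) = Y.mkQ x
        rw [rep_one_apply]
      map_mul' := fun g h => by
        ext ⟨_, x, hx, rfl⟩
        change Y.mkQ (ρ (g * h) x) = Y.mkQ (ρ g (ρ h x))
        rw [rep_mul_apply] }
  have hmem : ∀ x ∈ X, Y.mkQ x ∈ V' := fun x hx => ⟨x, hx, rfl⟩
  let φ₀ : X →ₗ[C] V' := Y.mkQ.restrict hmem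
  have hsurj : Function.Surjective φ₀ := by
    rintro ⟨_, x, hx, rfl⟩
    exact ⟨⟨x, hx⟩, rfl⟩
  have hker : ∀ x : X, φ₀ x = 0 ↔ (x : V) ∈ Y := fun x =>
    Subtype.ext_iff.trans (Submodule.Quotient.mk_eq_zero Y)
  obtain ⟨φ, hφ⟩ := LinearMap.exists_extend φ₀
  have hφX : ∀ x (hx : x ∈ X), φ x = φ₀ ⟨x, hx⟩ := fun x hx => LinearMap.congr_fun hφ ⟨x, hx⟩
  refine ⟨V', inferInstance, inferInstance, ρ', ⟨?_, ?_⟩, φ, fun s hs g => ?_, ?_⟩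
  · obtain ⟨x, hx, hxY⟩ := SetLike.exists_of_lt hYX
    exact ⟨⟨φ₀ ⟨x, hx⟩, 0, fun h => hxY ((hker _).1 h)⟩⟩
  · intro S' hS'
    let Z : Submodule C V := (S'.comap φ₀).map X.subtype
    have hYZ : Y ≤ Z := fun y hy =>
      ⟨⟨y, hYX.le hy⟩, by
        rw [SetLike.mem_coe, Submodule.mem_comap, (hker _).2 hy]; exact zero_mem _, rfl⟩
    have hZX : Z ≤ X := by rintro _ ⟨x, -, rfl⟩; exact x.2
    have hZ : ∀ g, Z ≤ Z.comap (ρ g) := by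
      rintro g _ ⟨x, hx, rfl⟩
      exact ⟨⟨ρ g x, hX g x.2⟩, hS' g _ hx, rfl⟩
    rcases hZX.lt_or_eq with h | h
    · left
      have hZY : Z = Y := (hYZ.lt_or_eq.resolve_left fun h' => hmax Z ⟨h, hZ⟩ h').symm
      rw [Submodule.eq_bot_iff]
      intro s hs
      obtain ⟨x, rfl⟩ := hsurj s
      rw [hker, ← hZY]
      exact ⟨x, hs, rfl⟩
    · right
      rw [Submodule.eq_top_iff']
      intro s
      obtain ⟨x, rfl⟩ := hsurj s
      obtain ⟨x', hx', hxx⟩ : (x : V) ∈ Z := h.symm.le x.2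
      have : x' = x := Subtype.ext hxx
      exact this ▸ hx'
  · rw [hφX _ (hXS s hs g), hφX _ (hSX s hs)]
    rfl
  · by_contra! hall
    refine not_le_of_gt hYX (Submodule.span_le.2 ?_)
    rintro _ ⟨s, hs, g, rfl⟩
    refine hYst g ?_
    have := hall s hs
    rwa [hφX _ (hSX s hs), hker] at this

end

section

variable {𝔽 : Type} [Field 𝔽] [Fintype 𝔽] {n : ℕ} {C : Type} [Field C]
  {W : Type} [AddCommGroup W] [Module C W] {b : Fin n → ℕ}

/-- The Levi component of an element of the opposite parabolic. -/
def lowerLevi (b : Fin n → ℕ) (g : GL (Fin n) 𝔽) (hg : transp g ∈ parabolic 𝔽 b) : Mgrp 𝔽 b :=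
  ⟨transp (leviProj b ⟨transp g, hg⟩), fun i j hij => leviProj_mem b ⟨transp g, hg⟩ j i hij.symm⟩

lemma lowerLevi_apply {g : GL (Fin n) 𝔽} (hg : transp g ∈ parabolic 𝔽 b) (i j : Fin n) :
    (lowerLevi b g hg).1.1 i j = if b i = b j then g.1 i j else 0 := by
  change (leviProj b ⟨transp g, hg⟩).1 j i = _
  rw [leviProj_apply, transp_apply]
  simp only [eq_comm]

lemma lowerLevi_mul {g h : GL (Fin n) 𝔽} (hg : transp g ∈ parabolic 𝔽 b)
    (hh : transp h ∈ parabolic 𝔽 b) (hgh : transp (g * h) ∈ parabolic 𝔽 b) :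
    lowerLevi b (g * h) hgh = lowerLevi b g hg * lowerLevi b h hh := by
  refine Subtype.ext ?_
  change transp _ = transp _ * transp _
  rw [← transp_mul, ← map_mul]
  congr 2
  exact Subtype.ext (transp_mul g h)

lemma transp_mem_parabolic_of_mem_Mgrp {g : GL (Fin n) 𝔽} (hg : g ∈ Mgrp 𝔽 b) :
    transp g ∈ parabolic 𝔽 b := fun i j hij => hg j i hij.ne

lemma lowerLevi_of_mem (m : Mgrp 𝔽 b) :
    lowerLevi b m.1 (transp_mem_parabolic_of_mem_Mgrp m.2) = m := by
  refine Subtype.ext ?_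
  ext i j
  rw [lowerLevi_apply]
  split_ifs with h
  · rfl
  · exact (m.2 i j h).symm

/-- Right translation on functions on a group. -/
def rightRegular (C Γ W : Type) [Field C] [Group Γ] [AddCommGroup W] [Module C W] :
    Representation C Γ (Γ → W) where
  toFun g := LinearMap.funLeft C W fun x => x * g
  map_one' := by ext F x; simp [LinearMap.funLeft]
  map_mul' g h := by
    ext F x
    change F (x * (g * h)) = F (x * g * h)
    rw [mul_assoc]

lemma rightRegular_apply {Γ : Type} [Group Γ] (g : Γ) (F : Γ → W) (x : Γ) :
    rightRegular C Γ W g F x = F (x * g) := rfl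

open Classical in
/-- The function supported on the opposite parabolic attached to a vector of a representation
of the Levi subgroup. -/
def bump (τ : Representation C (Mgrp 𝔽 b) W) : W →ₗ[C] (GL (Fin n) 𝔽 → W) :=
  LinearMap.pi fun x => if h : transp x ∈ parabolic 𝔽 b then τ (lowerLevi b x h) else 0

lemma bump_apply_of_mem (τ : Representation C (Mgrp 𝔽 b) W) (w : W) {x : GL (Fin n) 𝔽}
    (h : transp x ∈ parabolic 𝔽 b) : bump τ w x = τ (lowerLevi b x h) w := by
  simp [bump, h]

lemma bump_apply_of_notMem (τ : Representation C (Mgrp 𝔽 b) W) (w : W) {x : GL (Fin n) 𝔽}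
    (h : transp x ∉ parabolic 𝔽 b) : bump τ w x = 0 := by
  simp [bump, h]

lemma rightRegular_bump (τ : Representation C (Mgrp 𝔽 b) W) (w : W) {g : GL (Fin n) 𝔽}
    (hg : transp g ∈ parabolic 𝔽 b) :
    rightRegular C _ W g (bump τ w) = bump τ (τ (lowerLevi b g hg) w) := by
  ext x
  rw [rightRegular_apply]
  by_cases hx : transp x ∈ parabolic 𝔽 b
  · have hxg : transp (x * g) ∈ parabolic 𝔽 b := by
      rw [transp_mul]; exact mul_mem hg hx
    rw [bump_apply_of_mem τ _ hxg, bump_apply_of_mem τ _ hx, lowerLevi_mul hx hg, rep_mul_apply]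
  · rw [bump_apply_of_notMem τ _ hx, bump_apply_of_notMem]
    rw [transp_mul, Subgroup.mul_mem_cancel_left _ hg]
    exact hx

open Classical in
/-- The elements of the unipotent radical. -/
def radicalFin (𝔽 : Type) [Field 𝔽] [Fintype 𝔽] {n : ℕ} (b : Fin n → ℕ) :
    Finset (GL (Fin n) 𝔽) :=
  Finset.univ.filter (· ∈ radical 𝔽 b)

lemma mem_radicalFin {u : GL (Fin n) 𝔽} : u ∈ radicalFin 𝔽 b ↔ u ∈ radical 𝔽 b := by
  simp [radicalFin]

/-- The `N`-average of the functions `bump τ w`. -/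
def bumpSum (τ : Representation C (Mgrp 𝔽 b) W) : W →ₗ[C] (GL (Fin n) 𝔽 → W) :=
  ∑ u ∈ radicalFin 𝔽 b, (rightRegular C _ W u).comp (bump τ)

lemma bumpSum_apply (τ : Representation C (Mgrp 𝔽 b) W) (w : W) :
    bumpSum τ w = ∑ u ∈ radicalFin 𝔽 b, rightRegular C _ W u (bump τ w) := by
  simp [bumpSum]

lemma eq_one_of_mem_radical {u : GL (Fin n) 𝔽} (hu : u ∈ radical 𝔽 b)
    (hu' : transp u ∈ parabolic 𝔽 b) : u = 1 := by
  rw [mem_radical_iff] at hu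
  ext i j
  change u.1 i j = (1 : Matrix (Fin n) (Fin n) 𝔽) i j
  rw [Matrix.one_apply]
  rcases lt_trichotomy (b i) (b j) with h | h | h
  · have : i ≠ j := by rintro rfl; exact lt_irrefl _ h
    rw [if_neg this]
    exact hu' j i h
  · exact hu.2 i j h
  · have : i ≠ j := by rintro rfl; exact lt_irrefl _ h
    rw [if_neg this]
    exact hu.1 i j h

lemma bumpSum_apply_one (τ : Representation C (Mgrp 𝔽 b) W) (w : W) : bumpSum τ w 1 = w := by
  rw [bumpSum_apply, Finset.sum_apply, Finset.sum_eq_single 1]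
  · have h : transp (1 : GL (Fin n) 𝔽) ∈ parabolic 𝔽 b := by rw [transp_one]; exact one_mem _
    have h1 : lowerLevi b 1 h = 1 := lowerLevi_of_mem 1
    rw [rightRegular_apply, mul_one, bump_apply_of_mem τ w h, h1, rep_one_apply]
  · intro u hu hu1
    rw [rightRegular_apply, one_mul, bump_apply_of_notMem]
    exact fun h => hu1 (eq_one_of_mem_radical (mem_radicalFin.1 hu) h)
  · intro h
    exact absurd (mem_radicalFin.2 (one_mem _)) h

lemma radical_apply_bumpSum (τ : Representation C (Mgrp 𝔽 b) W) (w : W) {x : GL (Fin n) 𝔽}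
    (hx : x ∈ radical 𝔽 b) : rightRegular C _ W x (bumpSum τ w) = bumpSum τ w := by
  rw [bumpSum_apply, map_sum]
  refine Finset.sum_nbij' (fun u => x * u) (fun u => x⁻¹ * u) ?_ ?_ ?_ ?_ ?_
  · intro u hu
    exact mem_radicalFin.2 (mul_mem hx (mem_radicalFin.1 hu))
  · intro u hu
    exact mem_radicalFin.2 (mul_mem (inv_mem hx) (mem_radicalFin.1 hu))
  · intro u _; group
  · intro u _; group
  · intro u _
    rw [rep_mul_apply]

lemma levi_apply_bumpSum (τ : Representation C (Mgrp 𝔽 b) W) (w : W) (m : Mgrp 𝔽 b) :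
    rightRegular C _ W m.1 (bumpSum τ w) = bumpSum τ (τ m w) := by
  rw [bumpSum_apply, bumpSum_apply, map_sum]
  have hm := Mgrp_le_parabolic b m.2
  refine Finset.sum_nbij' (fun u => m.1 * u * m.1⁻¹) (fun u => m.1⁻¹ * u * m.1) ?_ ?_ ?_ ?_ ?_
  · intro u hu
    have := conj_mem_radical (inv_mem hm) (mem_radicalFin.1 hu)
    rw [inv_inv] at this
    exact mem_radicalFin.2 this
  · intro u hu
    exact mem_radicalFin.2 (conj_mem_radical hm (mem_radicalFin.1 hu))
  · intro u _; group
  · intro u _; group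
  · intro u _
    have h1 := rightRegular_bump τ w (transp_mem_parabolic_of_mem_Mgrp m.2)
    rw [lowerLevi_of_mem] at h1
    rw [← h1, ← rep_mul_apply, ← rep_mul_apply]
    congr 1
    congr 1
    group

/-- A permutation inverting exactly the pairs in distinct blocks. -/
lemma exists_block_reversal (hb : Monotone b) :
    ∃ w : Equiv.Perm (Fin n), ∀ a c : Fin n, a < c → (w⁻¹ a < w⁻¹ c ↔ b a = b c) := by
  let f : Fin n → ℕᵒᵈ ×ₗ Fin n := fun i => toLex (OrderDual.toDual (b i), i)
  have hinj : Function.Injective f := fun i j h => congrArg (fun x => (ofLex x).2) h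
  have hmono : StrictMono (f ∘ Tuple.sort f) :=
    (Tuple.monotone_sort f).strictMono_of_injective (hinj.comp (Tuple.sort f).injective)
  refine ⟨Tuple.sort f, fun a c hac => ?_⟩
  have hf : ∀ i, (f ∘ Tuple.sort f) ((Tuple.sort f)⁻¹ i) = f i := fun i =>
    congrArg f ((Tuple.sort f).apply_symm_apply i)
  rw [← hmono.lt_iff_lt, hf, hf, Prod.Lex.toLex_lt_toLex]
  have := hb hac.le
  change (b c < b a ∨ (b a = b c ∧ a < c)) ↔ _
  constructor
  · rintro (h | h)
    · omega
    · exact h.1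
  · intro h
    exact Or.inr ⟨h, hac⟩

/-- The `N`-average of `bump τ w` for a `U_M`-fixed torus eigenvector arises from a `U`-fixed
vector by applying the long intertwining operator. -/
lemma bumpSum_eq_weylSum (hb : Monotone b) (τ : Representation C (Mgrp 𝔽 b) W) {w₀ : W}
    (hw₀ : ∀ m : Mgrp 𝔽 b, m.1 ∈ unip 𝔽 n → τ m w₀ = w₀) :
    ∃ w : Equiv.Perm (Fin n), (∀ a c : Fin n, a < c → (w⁻¹ a < w⁻¹ c ↔ b a = b c)) ∧
      ∃ F ∈ fixedSub (rightRegular C _ W) (Uset 𝔽 n),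
        bumpSum τ w₀ = weylSum (rightRegular C _ W) w F := by
  obtain ⟨w, hw⟩ := exists_block_reversal hb
  refine ⟨w, hw, rightRegular C _ W (permGL w)⁻¹ (bump τ w₀), ?_, ?_⟩
  · rw [mem_fixed_unip]
    intro g hg
    rw [mem_unip] at hg
    have hP : transp (permGL w * g * (permGL w)⁻¹) ∈ parabolic 𝔽 b := by
      intro a c hac
      change (permGL w * g * (permGL w)⁻¹).1 c a = 0
      rw [conj_permGL_apply]
      have hca : c < a := hb.reflect_lt hac
      refine hg.1 _ _ (lt_of_le_of_ne (not_lt.1 fun h => ?_) ?_)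
      · exact hac.ne ((hw c a hca).1 h)
      · exact fun h => hca.ne' (w⁻¹.injective h)
    have hL : (lowerLevi b _ hP).1 ∈ unip 𝔽 n := by
      refine mem_unip.2 ⟨fun a c hca => ?_, fun a => ?_⟩
      · rw [lowerLevi_apply]
        split_ifs with h
        · rw [conj_permGL_apply]
          exact hg.1 _ _ ((hw c a hca).2 h.symm)
        · rfl
      · rw [lowerLevi_apply, if_pos rfl, conj_permGL_apply]
        exact hg.2 _
    have h1 := rightRegular_bump τ w₀ hP
    rw [hw₀ _ hL] at h1
    rw [← rep_mul_apply]
    conv_rhs => rw [← h1, ← rep_mul_apply]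
    congr 2
    group
  · rw [bumpSum_apply, weylSum]
    have : radicalFin 𝔽 b = invUnipFin 𝔽 w := by
      ext u
      rw [mem_radicalFin, mem_invUnipFin, mem_invUnip, mem_lowerUnip_iff]
      constructor
      · intro hu
        have hU := radical_le_unip hb hu
        rw [mem_radical_iff] at hu
        refine ⟨hU, fun i j hij => ?_, fun i => ?_⟩
        · rw [inv_conj_permGL_apply]
          rcases lt_trichotomy (w i) (w j) with h | h | h
          · rw [hu.2 _ _ ((hw _ _ h).1 (by simpa using hij)), if_neg h.ne]
          · exact absurd (w.injective h) hij.ne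
          · exact (mem_unip.1 hU).1 _ _ h
        · rw [inv_conj_permGL_apply]
          exact (mem_unip.1 hU).2 _
      · rintro ⟨hU, h1, h2⟩
        refine mem_radical_iff.2 ⟨fun i j hij => (mem_unip.1 hU).1 _ _ (hb.reflect_lt hij),
          fun i j hij => ?_⟩
        rcases lt_trichotomy i j with h | h | h
        · rw [if_neg h.ne]
          have h3 := h1 _ _ ((hw i j h).2 hij)
          rw [inv_conj_permGL_apply] at h3
          simpa using h3
        · rw [if_pos h, h]
          exact (mem_unip.1 hU).2 _
        · rw [if_neg h.ne']
          exact (mem_unip.1 hU).1 _ _ h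
    rw [this]
    refine Finset.sum_congr rfl fun u _ => ?_
    rw [← rep_mul_apply, mul_inv_cancel_right]

end

section

variable {𝔽 : Type} [Field 𝔽] [Fintype 𝔽] {n : ℕ} {C : Type} [Field C]
  {W : Type} [AddCommGroup W] [Module C W] {b : Fin n → ℕ}

/-- An irreducible representation of the Levi subgroup has a torus eigenvector fixed by the
unipotent upper triangular elements. -/
lemma exists_levi_highest_weight (p : ℕ) [Fact p.Prime] [CharP 𝔽 p] [CharP C p] [IsAlgClosed C]
    {τ : Representation C (Mgrp 𝔽 b) W} (hτ : IsIrredRep τ) :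
    ∃ w₀ ≠ 0, (∀ m : Mgrp 𝔽 b, m.1 ∈ unip 𝔽 n → τ m w₀ = w₀) ∧
      ∀ d, ∃ c : C, τ ⟨diagGL d, diagGL_mem_Mgrp b d⟩ w₀ = c • w₀ := by
  have hfd := hτ.finiteDimensional
  have hnt := hτ.1
  let H : Subgroup (Mgrp 𝔽 b) := (unip 𝔽 n).subgroupOf (Mgrp 𝔽 b)
  have hH : IsPGroup p H := (isPGroup_unip (n := n) (𝔽 := 𝔽) p).comap_of_injective
    (Mgrp 𝔽 b).subtype (Subgroup.subtype_injective _)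
  obtain ⟨x, -, hx0, hx⟩ := exists_fixed_of_isPGroup τ H hH ⊤ top_ne_bot
    fun _ _ _ _ => Submodule.mem_top
  let S : Submodule C W := fixedSub τ (H : Set (Mgrp 𝔽 b))
  have hS : S ≠ ⊥ := Submodule.ne_bot_iff _ |>.2 ⟨x, hx, hx0⟩
  let t : (Fin n → 𝔽ˣ) →* Mgrp 𝔽 b := diagGL.codRestrict _ (diagGL_mem_Mgrp b)
  obtain ⟨w₀, hw₀, hw₀0, hT⟩ := exists_common_eigenvector (τ.comp t) S hS fun d v hv m hm => by
    have h1 := hv _ (show (t d)⁻¹ * m * t d ∈ H from conj_diag_mem_unip d hm)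
    change τ m (τ (t d) v) = τ (t d) v
    conv_rhs => rw [← h1]
    rw [← rep_mul_apply, ← rep_mul_apply]
    congr 2
    group
  exact ⟨w₀, hw₀0, fun m hm => hw₀ m hm, hT⟩

/-- If the Hecke operator of a simple root acts through the torus on the fixed line, then the
simple reflection does not stabilize this line. -/
lemma swap_notMem_of_heckeOp (hchar : (Fintype.card 𝔽 : C) = 0) {V : Type} [AddCommGroup V]
    [Module C V] {ρ : Representation C (GL (Fin n) 𝔽) V} {v : V} (hv0 : v ≠ 0)
    (hspan : fixedSub ρ (Uset 𝔽 n) = Submodule.span C {v}) (hT : IsTorusEigen ρ v)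
    {i j : Fin n} (h : i < j) (hH : heckeOp ρ h.ne v = ∑ z : 𝔽ˣ, ρ (corootGL i j z) v) :
    permGL (Equiv.swap i j) ∉ fixedStab ρ := by
  intro hs
  have hv : v ∈ fixedSub ρ (Uset 𝔽 n) := hspan ▸ Submodule.mem_span_singleton_self v
  have hfix : ∀ x, ρ (elem h.ne x) v = v := fun x => mem_fixed_unip.1 hv _ (elem_mem_unip h x)
  obtain ⟨a, ha⟩ := Submodule.mem_span_singleton.1 (hspan ▸ apply_mem_of_mem_fixedStab hs hv)
  have haa : a * a = 1 := by
    have h1 := congrArg (fun g => ρ g v) (permGL_swap_mul_self (𝔽 := 𝔽) i j)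
    simp only [rep_mul_apply, ← ha, map_smul, rep_one_apply, smul_smul] at h1
    exact smul_left_injective C hv0 (h1.trans (one_smul C v).symm)
  have ha0 : a ≠ 0 := by rintro rfl; simp at haa
  have hzero : heckeOp ρ h.ne v = 0 := by
    simp only [heckeOp_apply, rep_mul_apply, ← ha, map_smul, hfix]
    rw [Finset.sum_const, Finset.card_univ, ← Nat.cast_smul_eq_nsmul C, hchar, zero_smul]
  have hχ : ∀ z : 𝔽ˣ, ρ (corootGL i j z) v = a • v := by
    intro z
    obtain ⟨c, hc⟩ : ∃ c : C, ρ (corootGL i j z) v = c • v := hT _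
    have h1 := congrArg (fun g => ρ g v) (elem_eq_bigCell h.ne z)
    simp only [rep_mul_apply, hfix, ← ha, map_smul, hc] at h1
    rw [← swap_conj_elem h.ne] at h1
    simp only [rep_mul_apply, hfix, ← ha, map_smul, smul_smul, haa] at h1
    have h2 : 1 = a * c := smul_left_injective C hv0 h1
    rw [hc]
    congr 1
    rw [← mul_right_inj' ha0, ← h2, haa]
  rw [hzero, Finset.sum_congr rfl fun z _ => hχ z, Finset.sum_const, Finset.card_univ,
    ← Nat.cast_smul_eq_nsmul C, smul_smul] at hH
  have hcard : (Fintype.card 𝔽ˣ : C) = -1 := by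
    have h1 : Fintype.card 𝔽ˣ + 1 = Fintype.card 𝔽 := by
      rw [← Nat.card_eq_fintype_card, ← Nat.card_eq_fintype_card, Nat.card_units]
      exact Nat.sub_add_cancel Nat.card_pos
    rw [eq_neg_iff_add_eq_zero, ← hchar, ← h1]
    push_cast
    rfl
  rw [hcard] at hH
  exact smul_ne_zero (mul_ne_zero (neg_ne_zero.2 one_ne_zero) ha0) hv0 hH.symm

lemma exists_regular_of_levi (p : ℕ) [Fact p.Prime] [CharP 𝔽 p] [CharP C p] [IsAlgClosed C]
    (hb : Monotone b) {τ : Representation C (Mgrp 𝔽 b) W} (hτ : IsIrredRep τ) :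
    ∃ (V : Type) (_ : AddCommGroup V) (_ : Module C V)
      (ρ : Representation C (GL (Fin n) 𝔽) V),
      IsIrredRep ρ ∧ PVset ρ ⊆ Pset 𝔽 b ∧
      ∃ e : fixedSub ρ (Nset 𝔽 b) ≃ₗ[C] W,
        ∀ (m : Mgrp 𝔽 b) (v w : fixedSub ρ (Nset 𝔽 b)),
          (w : V) = ρ m v → e w = τ m (e v) := by
  have hfd := hτ.finiteDimensional
  have hchar := card_cast_eq_zero (𝔽 := 𝔽) (C := C) p
  obtain ⟨w₀, hw₀0, hw₀, hw₀T⟩ := exists_levi_highest_weight p hτ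
  have hne : bumpSum τ w₀ ≠ 0 := fun h0 => hw₀0 (by
    rw [← bumpSum_apply_one τ w₀, h0, Pi.zero_apply])
  obtain ⟨V, _, _, ρ, hρ, φ, hφ, w₁, hw₁, hw₁0⟩ :=
    exists_irred_quotient (rightRegular C (GL (Fin n) 𝔽) W) (S := Set.range (bumpSum τ))
      ⟨w₀, rfl⟩ hne
  replace hφ : ∀ w g, φ (rightRegular C _ W g (bumpSum τ w)) = ρ g (φ (bumpSum τ w)) :=
    fun w g => hφ _ ⟨w, rfl⟩ g
  obtain ⟨w₁, rfl⟩ := hw₁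
  have hmem : ∀ w, φ (bumpSum τ w) ∈ fixedSub ρ (Nset 𝔽 b) := fun w =>
    mem_fixed_radical.2 fun x hx => by rw [← hφ, radical_apply_bumpSum τ w hx]
  let ψ : W →ₗ[C] fixedSub ρ (Nset 𝔽 b) := (φ.comp (bumpSum τ)).codRestrict _ hmem
  have hψ : ∀ (m : Mgrp 𝔽 b) w, (ψ (τ m w) : V) = ρ m.1 (ψ w) := fun m w => by
    change φ (bumpSum τ (τ m w)) = ρ m.1 (φ (bumpSum τ w))
    rw [← hφ, levi_apply_bumpSum]
  have hψ1 : ψ w₁ ≠ 0 := fun h => hw₁0 (congrArg Subtype.val h)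
  have hinj : Function.Injective ψ := by
    rw [← LinearMap.ker_eq_bot]
    refine (hτ.2 _ fun m w hw => ?_).resolve_right fun h => hψ1 ?_
    · rw [LinearMap.mem_ker] at hw ⊢
      refine Subtype.ext ?_
      rw [hψ, hw]
      exact map_zero _
    · exact LinearMap.mem_ker.1 (h ▸ Submodule.mem_top)
  have hsurj : Function.Surjective ψ := by
    have h1 := eq_bot_or_eq_fixed_radical p hb hρ (S := LinearMap.range (φ.comp (bumpSum τ)))
      (by rintro _ ⟨w, rfl⟩; exact hmem w)
      (by
        rintro m hm _ ⟨w, rfl⟩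
        exact ⟨τ ⟨m, hm⟩ w, hψ ⟨m, hm⟩ w⟩)
    have h2 := h1.resolve_left fun h => hw₁0 ((Submodule.mem_bot C).1 (h ▸ ⟨w₁, rfl⟩))
    intro v
    obtain ⟨w, hw⟩ := h2.symm.le v.2
    exact ⟨w, Subtype.ext hw⟩
  let e := LinearEquiv.ofBijective ψ ⟨hinj, hsurj⟩
  refine ⟨V, inferInstance, inferInstance, ρ, hρ, ?_, e.symm, fun m v w hvw => ?_⟩
  · set v := φ (bumpSum τ w₀) with hv_def
    have hv0 : v ≠ 0 := fun h => hw₀0 (hinj ((Subtype.ext h : ψ w₀ = 0).trans (map_zero ψ).symm))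
    obtain ⟨w, hw, F, hF, hwF⟩ := bumpSum_eq_weylSum hb τ hw₀
    have hv : v ∈ fixedSub ρ (Uset 𝔽 n) := mem_fixed_unip.2 fun g hg => by
      rw [hv_def, ← hφ]
      congr 1
      rw [hwF]
      exact mem_fixed_unip.1 (weylSum_mem_fixed hF w) g hg
    obtain ⟨hspan, hT, -⟩ := fixed_unip_vector p hρ hv hv0
    refine le_parabolic_of_simple (borel_le_fixedStab ρ) hb fun i j hij hs => ?_
    have h : i < j := by rw [Fin.lt_def]; omega
    by_contra hbij
    refine swap_notMem_of_heckeOp hchar hv0 hspan hT h ?_ hs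
    have hwij : w⁻¹ j < w⁻¹ i := lt_of_le_of_ne (not_lt.1 fun h' => hbij ((hw i j h).1 h'))
      fun h' => h.ne' (w⁻¹.injective h')
    have h1 := congrArg φ (heckeOp_weylSum_of_descent hchar _ hij h hwij hF)
    rw [← hwF, heckeOp_apply, map_sum, map_sum] at h1
    simp only [hφ] at h1
    rw [heckeOp_apply]
    exact h1
  · obtain ⟨x, rfl⟩ := e.surjective v
    have : w = e (τ m x) := Subtype.ext (hvw.trans (hψ m x).symm)
    rw [this, LinearEquiv.symm_apply_apply, LinearEquiv.symm_apply_apply]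

end

end SmithGL

theorem statement14 (p : ℕ) (hp : p.Prime) (q r : ℕ) (hr : 0 < r) (hq : q = p ^ r)
    (𝔽 : Type) [Field 𝔽] [Fintype 𝔽] (hcard : Fintype.card 𝔽 = q)
    (C : Type) [Field C] [IsAlgClosed C] (hC : CharP C p)
    (n : ℕ) (hn : 1 ≤ n) (b : Fin n → ℕ) (hb : Monotone b) :
    -- (a) for every irreducible V, V^N is an irreducible representation of M
    (∀ (V : Type) [AddCommGroup V] [Module C V],
      ∀ ρ : Representation C (GL (Fin n) 𝔽) V, IsIrredRep ρ →
      (∀ m ∈ Mgrp 𝔽 b, ∀ v ∈ fixedSub ρ (Nset 𝔽 b), ρ m v ∈ fixedSub ρ (Nset 𝔽 b)) ∧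
      fixedSub ρ (Nset 𝔽 b) ≠ ⊥ ∧
      (∀ S : Submodule C V, S ≤ fixedSub ρ (Nset 𝔽 b) →
        (∀ m ∈ Mgrp 𝔽 b, ∀ v ∈ S, ρ m v ∈ S) → S = ⊥ ∨ S = fixedSub ρ (Nset 𝔽 b))) ∧
    -- (b) every irreducible representation of M arises from an M-regular irreducible V
    (∀ (W : Type) [AddCommGroup W] [Module C W],
      ∀ τ : Representation C ↥(Mgrp 𝔽 b) W, IsIrredRep τ →
      ∃ (V : Type) (_ : AddCommGroup V) (_ : Module C V)
        (ρ : Representation C (GL (Fin n) 𝔽) V),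
        IsIrredRep ρ ∧ PVset ρ ⊆ Pset 𝔽 b ∧
        ∃ e : ↥(fixedSub ρ (Nset 𝔽 b)) ≃ₗ[C] W,
          ∀ (m : ↥(Mgrp 𝔽 b)) (v w : ↥(fixedSub ρ (Nset 𝔽 b))),
            (w : V) = ρ ↑m ↑v → e w = τ m (e v)) ∧
    -- (c) V ↦ V^N is injective on iso classes of M-regular irreducible representations
    (∀ (V₁ V₂ : Type) [AddCommGroup V₁] [Module C V₁] [AddCommGroup V₂] [Module C V₂],
      ∀ (ρ₁ : Representation C (GL (Fin n) 𝔽) V₁) (ρ₂ : Representation C (GL (Fin n) 𝔽) V₂),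
      IsIrredRep ρ₁ → IsIrredRep ρ₂ → PVset ρ₁ ⊆ Pset 𝔽 b → PVset ρ₂ ⊆ Pset 𝔽 b →
      (∃ e : ↥(fixedSub ρ₁ (Nset 𝔽 b)) ≃ₗ[C] ↥(fixedSub ρ₂ (Nset 𝔽 b)),
        ∀ (m : ↥(Mgrp 𝔽 b)) (v w : ↥(fixedSub ρ₁ (Nset 𝔽 b))),
          (w : V₁) = ρ₁ ↑m ↑v → (↑(e w) : V₂) = ρ₂ ↑m ↑(e v)) →
      ∃ E : V₁ ≃ₗ[C] V₂, ∀ (g : GL (Fin n) 𝔽) (v : V₁), E (ρ₁ g v) = ρ₂ g (E v)) ∧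
    -- (d) M-regular V with P_V = P correspond to one-dimensional representations of M
    (∀ (V : Type) [AddCommGroup V] [Module C V],
      ∀ ρ : Representation C (GL (Fin n) 𝔽) V, IsIrredRep ρ → PVset ρ ⊆ Pset 𝔽 b →
      (PVset ρ = Pset 𝔽 b ↔ Module.finrank C ↥(fixedSub ρ (Nset 𝔽 b)) = 1)) := by
  have hpf : Fact p.Prime := ⟨hp⟩
  have hp𝔽 : CharP 𝔽 p := charP_of_card_eq_prime_pow (f := r) (by
    rw [hcard, hq])
  refine ⟨fun V _ _ ρ hρ => ⟨?_, ?_, ?_⟩, fun W _ _ τ hτ => ?_, ?_, ?_⟩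
  · intro m hm v hv
    exact SmithGL.parabolic_apply_mem_fixed hv (SmithGL.Mgrp_le_parabolic b hm)
  · obtain ⟨v, hv0, hv, -⟩ := hρ.exists_lowerSpan_eq_top (p := p)
    exact (Submodule.ne_bot_iff _).2 ⟨v, SmithGL.fixed_unip_le_fixed_radical hb ρ hv, hv0⟩
  · intro S hS hM
    exact SmithGL.eq_bot_or_eq_fixed_radical p hb hρ hS hM
  · exact SmithGL.exists_regular_of_levi p hb hτ
  · rintro V₁ V₂ _ _ _ _ ρ₁ ρ₂ h₁ h₂ hr₁ hr₂ ⟨e, he⟩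
    exact SmithGL.exists_equiv_of_fixed_radical_equiv p hb h₁ h₂ hr₁ hr₂ e he
  · intro V _ _ ρ hρ hreg
    exact SmithGL.PVset_eq_Pset_iff p hb hρ hreg

end
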